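/- (Logarithmic inversion of the multiplier u²) Fix Λ, M, η, d₀ > 0, α ∈ (0,1] and a positive integer m. Assume Ω has the uniform interior cone property and satisfies the broken-line condition with parameter m. There exist constants C₀ > 0 and C₁ > 0, depending only on n, Ω, A, Λ, M, η, d₀, m and α, such that: for every measurable q with ‖q‖_{L^∞(Ω)} ≤ Λ, every u ∈ C²(Ω) ∩ C¹(closure(Ω)) that is a classical solution of L_q u = 0 with ‖u‖_{C¹(closure(Ω))} ≤ M and |u(x)| ≥ η whenever x ∈ closure(Ω) and dist(x, ∂Ω) ≤ d₀, and every α-Hölder continuous f : closure(Ω) → ℝ with sup|f| + [f]_α ≤ M, setting s := ‖f u²‖_{L^∞(Ω)}, if 0 < s < 1 then ‖f‖_{L^∞(Ω)} ≤ C₀ ( |ln(C₁ |ln s|)|^{−1/α} + s ). -/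

import Mathlib

open MeasureTheory Metric Set
open scoped RealInnerProductSpace

noncomputable section

/-- The `i`-th partial derivative of a real-valued function on `ℝⁿ`. -/
noncomputable def pd {n : ℕ} (i : Fin n) (f : EuclideanSpace ℝ (Fin n) → ℝ)
    (x : EuclideanSpace ℝ (Fin n)) : ℝ :=
  fderiv ℝ f x (EuclideanSpace.single i 1)

/-- `u` is a classical solution of `L_q u = ∑ᵢⱼ ∂ᵢ (aⁱʲ ∂ⱼ u) + q u = 0` pointwise in `Ω`. -/
def IsSolution {n : ℕ} (A : Fin n → Fin n → EuclideanSpace ℝ (Fin n) → ℝ)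
    (q u : EuclideanSpace ℝ (Fin n) → ℝ) (Ω : Set (EuclideanSpace ℝ (Fin n))) : Prop :=
  ∀ x ∈ Ω, (∑ i, ∑ j, pd i (fun y => A i j y * pd j u y) x) + q x * u x = 0

/-- The `H¹(D)` norm `(∫_D (w² + ‖∇w‖²))^{1/2}`. -/
noncomputable def H1Norm {n : ℕ} (D : Set (EuclideanSpace ℝ (Fin n)))
    (w : EuclideanSpace ℝ (Fin n) → ℝ) : ℝ :=
  (∫ x in D, ((w x) ^ 2 + ‖fderiv ℝ w x‖ ^ 2)) ^ (1 / 2 : ℝ)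

/-- `A = (aⁱʲ)` is symmetric, has `C¹` entries on `closure Ω`, and is uniformly elliptic. -/
def EllipticSym {n : ℕ} (Ω : Set (EuclideanSpace ℝ (Fin n)))
    (A : Fin n → Fin n → EuclideanSpace ℝ (Fin n) → ℝ) : Prop :=
  (∀ i j, ∀ x ∈ closure Ω, A i j x = A j i x) ∧
  (∀ i j, ContDiffOn ℝ 1 (A i j) (closure Ω)) ∧
  (∃ lam > 0, ∀ x ∈ Ω, ∀ ξ : EuclideanSpace ℝ (Fin n),
    lam * ‖ξ‖ ^ 2 ≤ ∑ i, ∑ j, A i j x * ξ i * ξ j)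

/-- Uniform interior cone property of `Ω`. -/
def UniformIntConeProperty {n : ℕ} (Ω : Set (EuclideanSpace ℝ (Fin n))) : Prop :=
  ∃ R > 0, ∃ θ₀ : ℝ, 0 < θ₀ ∧ θ₀ < Real.pi / 2 ∧
    ∀ xt ∈ frontier Ω, ∃ ξ : EuclideanSpace ℝ (Fin n), ‖ξ‖ = 1 ∧
      {x : EuclideanSpace ℝ (Fin n) |
        ‖x - xt‖ < 2 * R ∧ ‖x - xt‖ * Real.cos θ₀ < ⟪x - xt, ξ⟫} ⊆ Ω

/-- Any two points of `D` can be joined by a broken line in `D` with at most `m` segments. -/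
def BrokenLineCond {n : ℕ} (D : Set (EuclideanSpace ℝ (Fin n))) (m : ℕ) : Prop :=
  ∀ x ∈ D, ∀ y ∈ D, ∃ j ≤ m, ∃ z : ℕ → EuclideanSpace ℝ (Fin n),
    z 0 = x ∧ z j = y ∧ ∀ i < j, segment ℝ (z i) (z (i + 1)) ⊆ D

/-- `u ∈ C¹(closure Ω)` with `‖u‖_{C¹(closure Ω)} ≤ M`. -/
def C1BoundOn {n : ℕ} (Ω : Set (EuclideanSpace ℝ (Fin n)))
    (u : EuclideanSpace ℝ (Fin n) → ℝ) (M : ℝ) : Prop :=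
  ContDiffOn ℝ 1 u (closure Ω) ∧ (∀ x ∈ closure Ω, |u x| ≤ M) ∧
    ∀ x ∈ Ω, ‖fderiv ℝ u x‖ ≤ M

/-- `f` is `α`-Hölder on `closure Ω` with `sup |f| + [f]_α ≤ M`. -/
def HolderBoundOn {n : ℕ} (Ω : Set (EuclideanSpace ℝ (Fin n)))
    (f : EuclideanSpace ℝ (Fin n) → ℝ) (α M : ℝ) : Prop :=
  ∃ H : ℝ, 0 ≤ H ∧
    (∀ x ∈ closure Ω, ∀ y ∈ closure Ω, |f x - f y| ≤ H * ‖x - y‖ ^ α) ∧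
    ∀ x ∈ closure Ω, |f x| + H ≤ M



/-! ### Calculus with `pd` -/

abbrev EE (n : ℕ) := EuclideanSpace ℝ (Fin n)

lemma pd_add {n : ℕ} (i : Fin n) {f g : EE n → ℝ} {x : EE n}
    (hf : DifferentiableAt ℝ f x) (hg : DifferentiableAt ℝ g x) :
    pd i (fun y => f y + g y) x = pd i f x + pd i g x := by
  unfold pd
  rw [fderiv_fun_add hf hg]; rfl

lemma pd_sub {n : ℕ} (i : Fin n) {f g : EE n → ℝ} {x : EE n}
    (hf : DifferentiableAt ℝ f x) (hg : DifferentiableAt ℝ g x) :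
    pd i (fun y => f y - g y) x = pd i f x - pd i g x := by
  unfold pd
  rw [fderiv_fun_sub hf hg]; rfl

lemma pd_mul {n : ℕ} (i : Fin n) {f g : EE n → ℝ} {x : EE n}
    (hf : DifferentiableAt ℝ f x) (hg : DifferentiableAt ℝ g x) :
    pd i (fun y => f y * g y) x = pd i f x * g x + f x * pd i g x := by
  unfold pd
  rw [fderiv_fun_mul hf hg]
  simp; ring

lemma pd_const {n : ℕ} (i : Fin n) (c : ℝ) (x : EE n) : pd i (fun _ => c) x = 0 := by
  unfold pd; simp

lemma pd_const_mul {n : ℕ} (i : Fin n) (c : ℝ) {f : EE n → ℝ} {x : EE n}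
    (hf : DifferentiableAt ℝ f x) :
    pd i (fun y => c * f y) x = c * pd i f x := by
  rw [pd_mul i (by fun_prop) hf, pd_const]; ring

lemma pd_neg {n : ℕ} (i : Fin n) {f : EE n → ℝ} {x : EE n} :
    pd i (fun y => - f y) x = - pd i f x := by
  unfold pd; rw [fderiv_fun_neg]; rfl

lemma pd_sum {n : ℕ} (i : Fin n) {ι : Type*} (s : Finset ι) {f : ι → EE n → ℝ} {x : EE n}
    (hf : ∀ j, DifferentiableAt ℝ (f j) x) :
    pd i (fun y => ∑ j ∈ s, f j y) x = ∑ j ∈ s, pd i (f j) x := by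
  unfold pd
  rw [fderiv_fun_sum (fun j _ => hf j)]
  simp

lemma pd_comp {n : ℕ} (i : Fin n) {h : ℝ → ℝ} {f : EE n → ℝ} {x : EE n}
    (hh : DifferentiableAt ℝ h (f x)) (hf : DifferentiableAt ℝ f x) :
    pd i (fun y => h (f y)) x = deriv h (f x) * pd i f x := by
  unfold pd
  have := (hh.hasDerivAt.comp_hasFDerivAt x hf.hasFDerivAt).fderiv
  have h2 : (fun y => h (f y)) = h ∘ f := rfl
  rw [h2, this]; simp

lemma pd_congr {n : ℕ} (i : Fin n) {f g : EE n → ℝ} {x : EE n} (h : f =ᶠ[nhds x] g) :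
    pd i f x = pd i g x := by
  unfold pd; rw [h.fderiv_eq]

lemma pd_coord {n : ℕ} (i j : Fin n) (c x : EE n) :
    pd i (fun y : EE n => y j - c j) x = if i = j then 1 else 0 := by
  unfold pd
  rw [fderiv_sub_const]
  have : (fun y : EE n => y j) = (EuclideanSpace.proj j : EE n →L[ℝ] ℝ) := rfl
  rw [this, ContinuousLinearMap.fderiv]
  simp [eq_comm]

lemma contDiff_pd {n : ℕ} (i : Fin n) {f : EE n → ℝ} {a b : ℕ∞} (h : ContDiff ℝ b f)
    (hab : a + 1 ≤ b) : ContDiff ℝ a (pd i f) := by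
  unfold pd
  exact (h.fderiv_right (m := a) (by exact_mod_cast hab)).clm_apply contDiff_const

lemma contDiff_pd2 {n : ℕ} (i : Fin n) {f : EE n → ℝ} (h : ContDiff ℝ 2 f) :
    ContDiff ℝ 1 (pd i f) := by
  have := contDiff_pd i (a := 1) (b := 2) (f := f) (by exact_mod_cast h) (by norm_num)
  exact_mod_cast this

lemma continuous_pd1 {n : ℕ} (i : Fin n) {f : EE n → ℝ} (h : ContDiff ℝ 1 f) :
    Continuous (pd i f) := by
  have := contDiff_pd i (a := 0) (b := 1) (f := f) (by exact_mod_cast h) (by norm_num)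
  exact this.continuous

lemma pd_comm {n : ℕ} (i j : Fin n) {f : EE n → ℝ} (h : ContDiff ℝ 2 f) (x : EE n) :
    pd i (pd j f) x = pd j (pd i f) x := by
  have hs : IsSymmSndFDerivAt ℝ f x := by
    apply ContDiffAt.isSymmSndFDerivAt (n := 2) h.contDiffAt
    simp [minSmoothness_of_isRCLikeNormedField]
  have hd : DifferentiableAt ℝ (fderiv ℝ f) x :=
    (h.fderiv_right (m := 1) (by norm_num)).differentiable (by norm_num) x
  have key : ∀ v w : EE n, fderiv ℝ (fun y => fderiv ℝ f y v) x w = fderiv ℝ (fderiv ℝ f) x w v := by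
    intro v w
    rw [fderiv_clm_apply hd (by fun_prop)]
    simp
  unfold pd
  rw [key, key]
  exact hs _ _

lemma hasCompactSupport_pd {n : ℕ} (i : Fin n) {f : EE n → ℝ} (h : HasCompactSupport f) :
    HasCompactSupport (pd i f) := by
  apply h.mono'
  intro x hx
  by_contra hx'
  apply hx
  have : f =ᶠ[nhds x] fun _ => 0 := notMem_tsupport_iff_eventuallyEq.mp hx'
  rw [pd_congr i this, pd_const]

lemma integral_pd_eq_zero {n : ℕ} (i : Fin n) {f : EE n → ℝ} (h : ContDiff ℝ 1 f)
    (hc : HasCompactSupport f) : ∫ x, pd i f x = 0 := by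
  have h1 : Integrable (pd i f) :=
    (continuous_pd1 i h).integrable_of_hasCompactSupport (hasCompactSupport_pd i hc)
  have h2 : Integrable f := h.continuous.integrable_of_hasCompactSupport hc
  have := integral_mul_fderiv_eq_neg_fderiv_mul_of_integrable (μ := (volume : Measure (EE n)))
    (f := fun _ : EE n => (1 : ℝ)) (g := f) (v := EuclideanSpace.single i 1)
    (by simp)
    (by
      have h3 : Integrable (fun x => fderiv ℝ f x (EuclideanSpace.single i 1)) := h1
      simpa using h3) (by simpa using h2) (by intros; fun_prop)
    (by intro x _; exact h.differentiable (by norm_num) x)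
  simpa [pd] using this

lemma abs_sum_le' {n : ℕ} {f : Fin n → ℝ} {B : ℝ} (h : ∀ i, |f i| ≤ B) :
    |∑ i, f i| ≤ n * B := by
  calc |∑ i, f i| ≤ ∑ i, |f i| := Finset.abs_sum_le_sum_abs _ _
    _ ≤ ∑ _i : Fin n, B := Finset.sum_le_sum (fun i _ => h i)
    _ = n * B := by simp


/-- The flux `A ∇u`. -/
def PP {n : ℕ} (A : Fin n → Fin n → EE n → ℝ) (u : EE n → ℝ) (i : Fin n) (x : EE n) : ℝ :=
  ∑ j, A i j x * pd j u x

/-- The operator `div (A ∇u)`. -/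
def LL {n : ℕ} (A : Fin n → Fin n → EE n → ℝ) (u : EE n → ℝ) (x : EE n) : ℝ :=
  ∑ i, pd i (PP A u i) x

lemma contDiff_PP {n : ℕ} {A : Fin n → Fin n → EE n → ℝ} {u : EE n → ℝ}
    (hA : ∀ i j, ContDiff ℝ 1 (A i j)) (hu : ContDiff ℝ 2 u) (i : Fin n) :
    ContDiff ℝ 1 (PP A u i) := by
  unfold PP
  exact ContDiff.sum fun j _ => (hA i j).mul (contDiff_pd2 j hu)

lemma LL_eq {n : ℕ} {A : Fin n → Fin n → EE n → ℝ} {u : EE n → ℝ} {x : EE n}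
    (hA : ∀ i j, DifferentiableAt ℝ (A i j) x) (hu : ∀ j, DifferentiableAt ℝ (pd j u) x) :
    ∑ i, ∑ j, pd i (fun y => A i j y * pd j u y) x = LL A u x := by
  unfold LL PP
  refine Finset.sum_congr rfl fun i _ => ?_
  rw [pd_sum]
  exact fun j => (hA i j).mul (hu j)

/-- Leibniz rule for `div (A ∇ ·)`. -/
lemma LL_mul {n : ℕ} {A : Fin n → Fin n → EE n → ℝ} {f u : EE n → ℝ}
    (hA : ∀ i j, ContDiff ℝ 1 (A i j)) (hsym : ∀ i j x, A i j x = A j i x)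
    (hf : ContDiff ℝ 2 f) (hu : ContDiff ℝ 2 u) (x : EE n) :
    LL A (fun y => f y * u y) x
      = f x * LL A u x + 2 * ∑ i, PP A f i x * pd i u x + u x * LL A f x := by
  have df : Differentiable ℝ f := hf.differentiable (by norm_num)
  have du : Differentiable ℝ u := hu.differentiable (by norm_num)
  have hP : ∀ i, PP A (fun y => f y * u y) i = fun y => u y * PP A f i y + f y * PP A u i y := by
    intro i; funext y
    unfold PP
    rw [Finset.mul_sum, Finset.mul_sum, ← Finset.sum_add_distrib]
    refine Finset.sum_congr rfl fun j _ => ?_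
    rw [pd_mul j (df y) (du y)]; ring
  have dPf : ∀ i, Differentiable ℝ (PP A f i) :=
    fun i => (contDiff_PP hA hf i).differentiable (by norm_num)
  have dPu : ∀ i, Differentiable ℝ (PP A u i) :=
    fun i => (contDiff_PP hA hu i).differentiable (by norm_num)
  have hs : ∑ i, pd i f x * PP A u i x = ∑ i, PP A f i x * pd i u x := by
    unfold PP
    simp_rw [Finset.mul_sum, Finset.sum_mul]
    rw [Finset.sum_comm]
    refine Finset.sum_congr rfl fun i _ => Finset.sum_congr rfl fun j _ => ?_
    rw [hsym i j]; ring
  have h1 : LL A (fun y => f y * u y) x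
      = ∑ i, (pd i u x * PP A f i x + u x * pd i (PP A f i) x
          + (pd i f x * PP A u i x + f x * pd i (PP A u i) x)) := by
    unfold LL
    refine Finset.sum_congr rfl fun i _ => ?_
    rw [hP i, pd_add i ((du x).fun_mul (dPf i x)) ((df x).fun_mul (dPu i x)), pd_mul i (du x) (dPf i x),
      pd_mul i (df x) (dPu i x)]
  rw [h1]
  simp only [Finset.sum_add_distrib, hs, ← Finset.mul_sum]
  have h2 : ∑ i, pd i u x * PP A f i x = ∑ i, PP A f i x * pd i u x :=
    Finset.sum_congr rfl fun i _ => mul_comm _ _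
  rw [h2]
  unfold LL
  ring

/-- Rellich-type divergence identity. -/
lemma div_identity1 {n : ℕ} {A : Fin n → Fin n → EE n → ℝ} {β : Fin n → EE n → ℝ} {z : EE n → ℝ}
    (hA : ∀ i j, ContDiff ℝ 1 (A i j)) (hsym : ∀ i j x, A i j x = A j i x)
    (hβ : ∀ i, ContDiff ℝ 1 (β i)) (hz : ContDiff ℝ 2 z) (x : EE n) :
    ∑ i, pd i (fun y => 2 * ((∑ j, β j y * pd j z y) * PP A z i y)
        - β i y * ∑ j, PP A z j y * pd j z y) x
      = 2 * (∑ j, β j x * pd j z x) * LL A z x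
        + 2 * ∑ i, ∑ j, PP A z i x * pd i (β j) x * pd j z x
        - (∑ i, pd i (β i) x) * (∑ j, PP A z j x * pd j z x)
        - ∑ k, β k x * ∑ i, ∑ j, pd k (A i j) x * pd i z x * pd j z x := by
  have dA : ∀ i j, Differentiable ℝ (A i j) := fun i j => (hA i j).differentiable (by norm_num)
  have dβ : ∀ i, Differentiable ℝ (β i) := fun i => (hβ i).differentiable (by norm_num)
  have dz : ∀ i, Differentiable ℝ (pd i z) :=
    fun i => (contDiff_pd2 i hz).differentiable (by norm_num)
  have dP : ∀ i, Differentiable ℝ (PP A z i) :=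
    fun i => (contDiff_PP hA hz i).differentiable (by norm_num)
  have dB : Differentiable ℝ (fun y => ∑ j, β j y * pd j z y) := by fun_prop
  have dQ : Differentiable ℝ (fun y => ∑ j, PP A z j y * pd j z y) := by fun_prop
  have pB : ∀ i, pd i (fun y => ∑ j, β j y * pd j z y) x
      = ∑ j, (pd i (β j) x * pd j z x + β j x * pd i (pd j z) x) := by
    intro i
    rw [pd_sum i _ (fun j => ((dβ j).fun_mul (dz j)) x)]
    exact Finset.sum_congr rfl fun j _ => pd_mul i (dβ j x) (dz j x)
  have pP : ∀ k i, pd k (PP A z i) x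
      = ∑ j, (pd k (A i j) x * pd j z x + A i j x * pd k (pd j z) x) := by
    intro k i
    unfold PP
    rw [pd_sum k _ (fun j => ((dA i j).fun_mul (dz j)) x)]
    exact Finset.sum_congr rfl fun j _ => pd_mul k (dA i j x) (dz j x)
  have pQ : ∀ k, pd k (fun y => ∑ j, PP A z j y * pd j z y) x
      = ∑ i, ∑ j, pd k (A i j) x * pd i z x * pd j z x
        + 2 * ∑ i, PP A z i x * pd k (pd i z) x := by
    intro k
    rw [pd_sum k _ (fun j => ((dP j).fun_mul (dz j)) x)]
    have : ∀ j, pd k (fun y => PP A z j y * pd j z y) x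
        = pd k (PP A z j) x * pd j z x + PP A z j x * pd k (pd j z) x :=
      fun j => pd_mul k (dP j x) (dz j x)
    simp_rw [this, pP]
    rw [Finset.sum_add_distrib, two_mul, ← add_assoc]
    congr 1
    simp_rw [Finset.sum_mul, add_mul, Finset.sum_add_distrib]
    congr 1
    · refine Finset.sum_congr rfl fun i _ => Finset.sum_congr rfl fun j _ => by ring
    · unfold PP
      simp_rw [Finset.sum_mul]
      rw [Finset.sum_comm]
      refine Finset.sum_congr rfl fun i _ => Finset.sum_congr rfl fun j _ => ?_
      rw [hsym i j]; ring
  have step : ∀ i, pd i (fun y => 2 * ((∑ j, β j y * pd j z y) * PP A z i y)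
        - β i y * ∑ j, PP A z j y * pd j z y) x
      = 2 * ((∑ j, (pd i (β j) x * pd j z x + β j x * pd i (pd j z) x)) * PP A z i x
          + (∑ j, β j x * pd j z x) * pd i (PP A z i) x)
        - (pd i (β i) x * (∑ j, PP A z j x * pd j z x)
          + β i x * (∑ k, ∑ j, pd i (A k j) x * pd k z x * pd j z x
            + 2 * ∑ k, PP A z k x * pd i (pd k z) x)) := by
    intro i
    rw [pd_sub i (((dB.fun_mul (dP i)).const_mul 2) x) (((dβ i).fun_mul dQ) x),
      pd_const_mul i 2 ((dB.fun_mul (dP i)) x), pd_mul i (dB x) (dP i x), pd_mul i (dβ i x) (dQ x),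
      pB, pQ]
  simp_rw [step]
  have hH : ∑ i, (∑ j, β j x * pd i (pd j z) x) * PP A z i x
      = ∑ i, β i x * ∑ k, PP A z k x * pd i (pd k z) x := by
    simp_rw [Finset.sum_mul, Finset.mul_sum]
    rw [Finset.sum_comm]
    refine Finset.sum_congr rfl fun i _ => Finset.sum_congr rfl fun j _ => ?_
    rw [pd_comm j i hz x]; ring
  have hG : ∑ i, (∑ j, pd i (β j) x * pd j z x) * PP A z i x
      = ∑ i, ∑ j, PP A z i x * pd i (β j) x * pd j z x := by
    simp_rw [Finset.sum_mul]
    refine Finset.sum_congr rfl fun i _ => Finset.sum_congr rfl fun j _ => by ring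
  simp only [Finset.sum_sub_distrib, Finset.sum_add_distrib, ← Finset.mul_sum, add_mul, mul_add,
    ← Finset.sum_mul]
  rw [hH, hG]
  have h3 : ∑ i, β i x * (2 * ∑ k, PP A z k x * pd i (pd k z) x)
      = 2 * ∑ i, β i x * ∑ k, PP A z k x * pd i (pd k z) x := by
    rw [Finset.mul_sum]
    exact Finset.sum_congr rfl fun i _ => by ring
  rw [h3]
  unfold LL
  ring

lemma div_identity2 {n : ℕ} {β : Fin n → EE n → ℝ} {b z : EE n → ℝ}
    (hβ : ∀ i, ContDiff ℝ 1 (β i)) (hb : ContDiff ℝ 1 b) (hz : ContDiff ℝ 2 z) (x : EE n) :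
    ∑ i, pd i (fun y => b y * β i y * (z y * z y)) x
      = (b x * (∑ i, pd i (β i) x) + ∑ i, β i x * pd i b x) * z x ^ 2
        + 2 * b x * z x * ∑ j, β j x * pd j z x := by
  have dβ : ∀ i, Differentiable ℝ (β i) := fun i => (hβ i).differentiable (by norm_num)
  have db : Differentiable ℝ b := hb.differentiable (by norm_num)
  have dz : Differentiable ℝ z := hz.differentiable (by norm_num)
  have step : ∀ i, pd i (fun y => b y * β i y * (z y * z y)) x
      = b x * pd i (β i) x * z x ^ 2 + β i x * pd i b x * z x ^ 2
        + 2 * b x * z x * (β i x * pd i z x) := by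
    intro i
    rw [pd_mul i ((db.fun_mul (dβ i)) x) ((dz.fun_mul dz) x), pd_mul i (db x) (dβ i x),
      pd_mul i (dz x) (dz x)]
    ring
  simp_rw [step, Finset.sum_add_distrib, ← Finset.sum_mul, ← Finset.mul_sum]
  ring

lemma div_identity3 {n : ℕ} {A : Fin n → Fin n → EE n → ℝ} {g z w : EE n → ℝ}
    (hA : ∀ i j, ContDiff ℝ 1 (A i j))
    (hg : ContDiff ℝ 1 g) (hw : ContDiff ℝ 1 w) (hz : ContDiff ℝ 2 z) (x : EE n) :
    ∑ i, pd i (fun y => g y * w y * PP A z i y) x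
      = g x * w x * LL A z x + w x * (∑ i, PP A z i x * pd i g x)
        + g x * ∑ i, PP A z i x * pd i w x := by
  have dg : Differentiable ℝ g := hg.differentiable (by norm_num)
  have dw : Differentiable ℝ w := hw.differentiable (by norm_num)
  have dP : ∀ i, Differentiable ℝ (PP A z i) :=
    fun i => (contDiff_PP hA hz i).differentiable (by norm_num)
  have step : ∀ i, pd i (fun y => g y * w y * PP A z i y) x
      = g x * w x * pd i (PP A z i) x + w x * (PP A z i x * pd i g x)
        + g x * (PP A z i x * pd i w x) := by
    intro i
    rw [pd_mul i ((dg.fun_mul dw) x) (dP i x), pd_mul i (dg x) (dw x)]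
    ring
  simp_rw [step, Finset.sum_add_distrib, ← Finset.mul_sum]
  rfl


/-! ### The Carleman weight and related functions -/

def yy {n : ℕ} (c : EE n) (j : Fin n) (x : EE n) : ℝ := x j - c j

def NN {n : ℕ} (c x : EE n) : ℝ := ∑ j, yy c j x * yy c j x

def iot {n : ℕ} (c : EE n) (δ : ℝ) (x : EE n) : ℝ := (NN c x + δ)⁻¹

def kap {n : ℕ} (c : EE n) (δ : ℝ) (k : ℕ) (x : EE n) : ℝ := 2 * k * iot c δ x ^ (k + 1)

def mm {n : ℕ} (c : EE n) (δ : ℝ) (k : ℕ) (x : EE n) : ℝ := 2 * (k + 1) * iot c δ x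

def pp {n : ℕ} (A : Fin n → Fin n → EE n → ℝ) (c : EE n) (i : Fin n) (x : EE n) : ℝ :=
  ∑ j, A i j x * yy c j x

def ee {n : ℕ} (A : Fin n → Fin n → EE n → ℝ) (c : EE n) (x : EE n) : ℝ :=
  ∑ j, pp A c j x * yy c j x

def beta {n : ℕ} (A : Fin n → Fin n → EE n → ℝ) (c : EE n) (δ : ℝ) (k : ℕ) (i : Fin n)
    (x : EE n) : ℝ := -(kap c δ k x * pp A c i x)

def bb {n : ℕ} (A : Fin n → Fin n → EE n → ℝ) (c : EE n) (δ : ℝ) (k : ℕ)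
    (x : EE n) : ℝ := kap c δ k x * kap c δ k x * ee A c x

def gg {n : ℕ} (A : Fin n → Fin n → EE n → ℝ) (c : EE n) (δ : ℝ) (k : ℕ)
    (x : EE n) : ℝ := 2 * (kap c δ k x * (mm c δ k x * ee A c x))

lemma NN_eq {n : ℕ} (c x : EE n) : NN c x = ‖x - c‖ ^ 2 := by
  rw [EuclideanSpace.norm_sq_eq]
  unfold NN yy
  refine Finset.sum_congr rfl fun j _ => ?_
  simp; ring

lemma NN_nonneg {n : ℕ} (c x : EE n) : 0 ≤ NN c x := by
  rw [NN_eq]; positivity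

lemma contDiff_yy {n : ℕ} (c : EE n) (j : Fin n) {a : WithTop ℕ∞} : ContDiff ℝ a (yy c j) := by
  unfold yy
  have : ContDiff ℝ a (fun y : EE n => y j) :=
    (EuclideanSpace.proj j : EE n →L[ℝ] ℝ).contDiff
  exact this.sub contDiff_const

lemma contDiff_NN {n : ℕ} (c : EE n) {a : WithTop ℕ∞} : ContDiff ℝ a (NN c) := by
  unfold NN
  exact ContDiff.sum fun j _ => (contDiff_yy c j).mul (contDiff_yy c j)

lemma contDiff_iot {n : ℕ} (c : EE n) {δ : ℝ} (hδ : 0 < δ) {a : WithTop ℕ∞} :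
    ContDiff ℝ a (iot c δ) := by
  unfold iot
  refine ((contDiff_NN c).add contDiff_const).inv fun x => ?_
  have := NN_nonneg c x
  positivity

lemma contDiff_kap {n : ℕ} (c : EE n) {δ : ℝ} (hδ : 0 < δ) (k : ℕ) {a : WithTop ℕ∞} :
    ContDiff ℝ a (kap c δ k) := by
  unfold kap
  exact contDiff_const.mul ((contDiff_iot c hδ).pow _)

lemma contDiff_mm {n : ℕ} (c : EE n) {δ : ℝ} (hδ : 0 < δ) (k : ℕ) {a : WithTop ℕ∞} :
    ContDiff ℝ a (mm c δ k) := by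
  unfold mm
  exact contDiff_const.mul (contDiff_iot c hδ)

section
variable {n : ℕ} {A : Fin n → Fin n → EE n → ℝ} (hA : ∀ i j, ContDiff ℝ 1 (A i j))
  (c : EE n) {δ : ℝ} (hδ : 0 < δ) (k : ℕ)
include hA

lemma contDiff_pp (i : Fin n) : ContDiff ℝ 1 (pp A c i) := by
  unfold pp
  exact ContDiff.sum fun j _ => (hA i j).mul (contDiff_yy c j)

lemma contDiff_ee : ContDiff ℝ 1 (ee A c) := by
  unfold ee
  exact ContDiff.sum fun j _ => (contDiff_pp hA c j).mul (contDiff_yy c j)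

lemma pd_pp (i j : Fin n) (x : EE n) :
    pd i (pp A c j) x = (∑ l, pd i (A j l) x * yy c l x) + A j i x := by
  have dA : ∀ i j, Differentiable ℝ (A i j) := fun i j => (hA i j).differentiable (by norm_num)
  have dy : ∀ i, Differentiable ℝ (yy c i) := fun i => (contDiff_yy c i (a := 1)).differentiable (by norm_num)
  unfold pp
  rw [pd_sum i _ (fun l => ((dA j l).fun_mul (dy l)) x)]
  have : ∀ l, pd i (fun y => A j l y * yy c l y) x
      = pd i (A j l) x * yy c l x + (if i = l then A j l x else 0) := by
    intro l
    rw [pd_mul i (dA j l x) (dy l x)]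
    congr 1
    unfold yy
    rw [pd_coord]; simp
  simp_rw [this, Finset.sum_add_distrib]
  simp

lemma pd_ee (i : Fin n) (x : EE n) :
    pd i (ee A c) x = (∑ l, pd i (pp A c l) x * yy c l x) + pp A c i x := by
  have dp : ∀ i, Differentiable ℝ (pp A c i) := fun i => (contDiff_pp hA c i).differentiable (by norm_num)
  have dy : ∀ i, Differentiable ℝ (yy c i) := fun i => (contDiff_yy c i (a := 1)).differentiable (by norm_num)
  unfold ee
  rw [pd_sum i _ (fun l => ((dp l).fun_mul (dy l)) x)]
  have : ∀ l, pd i (fun y => pp A c l y * yy c l y) x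
      = pd i (pp A c l) x * yy c l x + (if i = l then pp A c l x else 0) := by
    intro l
    rw [pd_mul i (dp l x) (dy l x)]
    congr 1
    unfold yy
    rw [pd_coord]; simp
  simp_rw [this, Finset.sum_add_distrib]
  simp
end

lemma pd_NN {n : ℕ} (c : EE n) (i : Fin n) (x : EE n) : pd i (NN c) x = 2 * yy c i x := by
  have dy : ∀ i, Differentiable ℝ (yy c i) := fun i => (contDiff_yy c i (a := 1)).differentiable (by norm_num)
  unfold NN
  rw [pd_sum i _ (fun l => ((dy l).fun_mul (dy l)) x)]
  have : ∀ l, pd i (fun y => yy c l y * yy c l y) x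
      = (if i = l then 2 * yy c l x else 0) := by
    intro l
    rw [pd_mul i (dy l x) (dy l x)]
    have : pd i (yy c l) x = if i = l then 1 else 0 := pd_coord i l c x
    rw [this]; split_ifs <;> ring
  simp_rw [this]
  simp

lemma pd_iot {n : ℕ} (c : EE n) {δ : ℝ} (hδ : 0 < δ) (i : Fin n) (x : EE n) :
    pd i (iot c δ) x = - (2 * iot c δ x ^ 2 * yy c i x) := by
  have h0 : NN c x + δ ≠ 0 := by have := NN_nonneg c x; positivity
  have dN : Differentiable ℝ (NN c) := (contDiff_NN c (a := 1)).differentiable (by norm_num)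
  have h1 := pd_comp i (h := fun t : ℝ => (t + δ)⁻¹) (f := NN c) (x := x)
    (by fun_prop (disch := exact h0)) (dN x)
  have h2 : deriv (fun t : ℝ => (t + δ)⁻¹) (NN c x) = - ((NN c x + δ) ^ 2)⁻¹ := by
    have := ((hasDerivAt_id (NN c x)).add_const δ).fun_inv h0
    simp only [id] at this
    rw [this.deriv]; simp [neg_div]
  rw [h2, pd_NN] at h1
  have h3 : iot c δ = fun y => (NN c y + δ)⁻¹ := rfl
  rw [h3, h1]; rw [inv_pow]; ring

lemma pd_pow_iot {n : ℕ} (c : EE n) {δ : ℝ} (hδ : 0 < δ) (k : ℕ) (i : Fin n) (x : EE n) :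
    pd i (fun y => iot c δ y ^ (k + 1)) x
      = - (2 * (k + 1) * iot c δ x ^ (k + 2) * yy c i x) := by
  have dI : Differentiable ℝ (iot c δ) := (contDiff_iot c hδ (a := 1)).differentiable (by norm_num)
  rw [pd_comp i (h := fun t : ℝ => t ^ (k + 1)) (by fun_prop) (dI x), pd_iot c hδ]
  simp; ring

lemma pd_kap {n : ℕ} (c : EE n) {δ : ℝ} (hδ : 0 < δ) (k : ℕ) (i : Fin n) (x : EE n) :
    pd i (kap c δ k) x = - (mm c δ k x * kap c δ k x * yy c i x) := by
  have dI : Differentiable ℝ (fun y => iot c δ y ^ (k + 1)) :=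
    ((contDiff_iot c hδ (a := 1)).pow _).differentiable (by norm_num)
  unfold kap
  rw [pd_const_mul i _ (dI x), pd_pow_iot c hδ]
  unfold mm; ring

lemma pd_mm {n : ℕ} (c : EE n) {δ : ℝ} (hδ : 0 < δ) (k : ℕ) (i : Fin n) (x : EE n) :
    pd i (mm c δ k) x = - (2 * iot c δ x * mm c δ k x * yy c i x) := by
  have dI : Differentiable ℝ (iot c δ) := (contDiff_iot c hδ (a := 1)).differentiable (by norm_num)
  unfold mm
  rw [pd_const_mul i _ (dI x), pd_iot c hδ]
  ring

/-- the weight `φ = (N+δ)^{-k}` with `k = k'+1`. -/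
lemma pd_phi {n : ℕ} (c : EE n) {δ : ℝ} (hδ : 0 < δ) (k : ℕ) (hk : 1 ≤ k) (i : Fin n) (x : EE n) :
    pd i (fun y => iot c δ y ^ k) x = - (kap c δ k x * yy c i x) := by
  obtain ⟨l, rfl⟩ : ∃ l, k = l + 1 := ⟨k - 1, by omega⟩
  rw [pd_pow_iot c hδ]
  unfold kap; push_cast; ring

section
variable {n : ℕ} {A : Fin n → Fin n → EE n → ℝ} (hA : ∀ i j, ContDiff ℝ 1 (A i j))
  (c : EE n) {δ : ℝ} (hδ : 0 < δ) (k : ℕ)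
include hA hδ

lemma contDiff_beta (i : Fin n) : ContDiff ℝ 1 (beta A c δ k i) := by
  unfold beta
  exact ((contDiff_kap c hδ k).mul (contDiff_pp hA c i)).neg

lemma contDiff_bb : ContDiff ℝ 1 (bb A c δ k) := by
  unfold bb
  exact ((contDiff_kap c hδ k).mul (contDiff_kap c hδ k)).mul (contDiff_ee hA c)

lemma contDiff_gg : ContDiff ℝ 1 (gg A c δ k) := by
  unfold gg
  exact contDiff_const.mul ((contDiff_kap c hδ k).mul ((contDiff_mm c hδ k).mul (contDiff_ee hA c)))

lemma pd_beta (i j : Fin n) (x : EE n) :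
    pd i (beta A c δ k j) x
      = kap c δ k x * (mm c δ k x * yy c i x * pp A c j x - pd i (pp A c j) x) := by
  have dk : Differentiable ℝ (kap c δ k) := (contDiff_kap c hδ k (a := 1)).differentiable (by norm_num)
  have dp : ∀ i, Differentiable ℝ (pp A c i) := fun i => (contDiff_pp hA c i).differentiable (by norm_num)
  unfold beta
  rw [pd_neg, pd_mul i (dk x) (dp j x), pd_kap c hδ]; ring

lemma pd_bb (i : Fin n) (x : EE n) :
    pd i (bb A c δ k) x
      = kap c δ k x ^ 2 * (pd i (ee A c) x - 2 * mm c δ k x * yy c i x * ee A c x) := by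
  have dk : Differentiable ℝ (kap c δ k) := (contDiff_kap c hδ k (a := 1)).differentiable (by norm_num)
  have de : Differentiable ℝ (ee A c) := (contDiff_ee hA c).differentiable (by norm_num)
  unfold bb
  rw [pd_mul i ((dk.fun_mul dk) x) (de x), pd_mul i (dk x) (dk x), pd_kap c hδ]; ring

lemma pd_gg (i : Fin n) (x : EE n) :
    pd i (gg A c δ k) x
      = 2 * kap c δ k x * mm c δ k x *
        (pd i (ee A c) x - (mm c δ k x + 2 * iot c δ x) * yy c i x * ee A c x) := by
  have dk : Differentiable ℝ (kap c δ k) := (contDiff_kap c hδ k (a := 1)).differentiable (by norm_num)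
  have dm : Differentiable ℝ (mm c δ k) := (contDiff_mm c hδ k (a := 1)).differentiable (by norm_num)
  have de : Differentiable ℝ (ee A c) := (contDiff_ee hA c).differentiable (by norm_num)
  unfold gg
  rw [pd_const_mul i _ ((dk.fun_mul (dm.fun_mul de)) x), pd_mul i (dk x) ((dm.fun_mul de) x),
    pd_mul i (dm x) (de x), pd_kap c hδ, pd_mm c hδ]; ring
end


/-! ### Pointwise bounds -/

lemma abs_mul_le' {a b A B : ℝ} (ha : |a| ≤ A) (hb : |b| ≤ B) : |a * b| ≤ A * B := by
  rw [abs_mul]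
  exact mul_le_mul ha hb (abs_nonneg _) ((abs_nonneg _).trans ha)

section
variable {n : ℕ} {A : Fin n → Fin n → EE n → ℝ} (hA : ∀ i j, ContDiff ℝ 1 (A i j))
  {c x : EE n} {K D Y : ℝ}
  (ha : ∀ i j, |A i j x| ≤ K) (hda : ∀ k i j, |pd k (A i j) x| ≤ K)
  (hy : ∀ i, |yy c i x| ≤ Y) (hYD : Y ≤ D)

include ha hy in
lemma pp_bound (i : Fin n) : |pp A c i x| ≤ n * (K * Y) :=
  abs_sum_le' fun j => abs_mul_le' (ha i j) (hy j)

include ha hy in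
lemma ee_bound : |ee A c x| ≤ n * (n * (K * Y) * Y) :=
  abs_sum_le' fun j => abs_mul_le' (pp_bound ha hy j) (hy j)

include hA ha hda hy hYD in
lemma dpp_bound (hK : 0 ≤ K) (i j : Fin n) : |pd i (pp A c j) x| ≤ n * (K * D) + K := by
  rw [pd_pp hA]
  refine (abs_add_le _ _).trans (add_le_add ?_ (ha j i))
  refine abs_sum_le' fun l => (abs_mul_le' (hda i j l) (hy l)).trans ?_
  exact mul_le_mul_of_nonneg_left hYD hK

include hA ha hda hy hYD in
lemma dee_bound (hK : 0 ≤ K) (i : Fin n) :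
    |pd i (ee A c) x| ≤ (n * (n * (K * D) + K) + n * K) * Y := by
  rw [pd_ee hA]
  have h1 := abs_sum_le' (n := n) fun l =>
    abs_mul_le' (dpp_bound hA ha hda hy hYD hK i l) (hy l)
  have h2 := pp_bound ha hy i
  refine (abs_add_le _ _).trans ((add_le_add h1 h2).trans (le_of_eq (by ring)))

include hA ha hda hy hYD in
lemma sum_dpp_bound (hK : 0 ≤ K) :
    |∑ i, pd i (pp A c i) x| ≤ n * (n * (K * D) + K) :=
  abs_sum_le' fun i => dpp_bound hA ha hda hy hYD hK i i

include hA ha hda hy hYD in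
lemma rem2_bound (hK : 0 ≤ K) :
    |ee A c x * (∑ i, pd i (pp A c i) x) + ∑ i, pp A c i x * pd i (ee A c) x|
      ≤ (n * n * K * (n * (n * (K * D) + K))
        + n * (n * K * (n * (n * (K * D) + K) + n * K))) * Y ^ 2 := by
  have h1 := abs_mul_le' (ee_bound ha hy) (sum_dpp_bound hA ha hda hy hYD hK)
  have h2 := abs_sum_le' (n := n) fun l =>
    abs_mul_le' (pp_bound ha hy l) (dee_bound hA ha hda hy hYD hK l)
  exact (abs_add_le _ _).trans ((add_le_add h1 h2).trans (le_of_eq (by ring)))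

include ha in
lemma PP_bound {z : EE n → ℝ} {X : ℝ} (hX : ∀ i, |pd i z x| ≤ X) (i : Fin n) :
    |PP A z i x| ≤ n * (K * X) :=
  abs_sum_le' fun j => abs_mul_le' (ha i j) (hX j)

include hA ha hda hy hYD in
lemma rem1_bound (hK : 0 ≤ K) {z : EE n → ℝ} {X : ℝ} (hX : ∀ i, |pd i z x| ≤ X) :
    |(∑ i, pd i (pp A c i) x) * (∑ j, PP A z j x * pd j z x)
      - 2 * (∑ i, ∑ j, PP A z i x * pd i (pp A c j) x * pd j z x)
      + ∑ k, pp A c k x * ∑ i, ∑ j, pd k (A i j) x * pd i z x * pd j z x|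
      ≤ (n * (n * (K * D) + K) * (n * n * K) + 2 * (n * n * (n * K * (n * (K * D) + K)))
        + n * (n * K * D * (n * n * K))) * X ^ 2 := by
  have hP := PP_bound ha hX
  have h1 := abs_mul_le' (sum_dpp_bound hA ha hda hy hYD hK)
    (abs_sum_le' (n := n) fun l => abs_mul_le' (hP l) (hX l))
  have h2 := abs_sum_le' (n := n) fun i => abs_sum_le' (n := n) fun j =>
    abs_mul_le' (abs_mul_le' (hP i) (dpp_bound hA ha hda hy hYD hK i j)) (hX j)
  have hp : ∀ k, |pp A c k x| ≤ n * (K * D) := fun k => (pp_bound ha hy k).trans (by gcongr)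
  have h3 := abs_sum_le' (n := n) fun k => abs_mul_le' (hp k) (abs_sum_le' (n := n) fun i =>
    abs_sum_le' (n := n) fun j => abs_mul_le' (abs_mul_le' (hda k i j) (hX i)) (hX j))
  have h4 : ∀ a b c : ℝ, |a - 2 * b + c| ≤ |a| + 2 * |b| + |c| := by
    intro a b c
    refine (abs_add_le _ _).trans (add_le_add_left ((abs_sub _ _).trans ?_) _)
    rw [abs_mul, abs_two]
  refine (h4 _ _ _).trans ((add_le_add (add_le_add h1 (mul_le_mul_of_nonneg_left h2 zero_le_two)) h3).trans
    (le_of_eq (by ring)))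
end

set_option maxHeartbeats 1000000 in
/-- scalar inequality behind the Carleman estimate -/
lemma carleman_scalar {H H2 G κ ι N Y X z τ C4 C5 κ0 B Λ dd t0 : ℝ}
    (hτ : 0 < τ) (hκ0 : 0 < κ0) (hι : 0 < ι) (hκ : κ0 * ι ≤ κ)
    (hH : κ * X ^ 2 ≤ H) (hH2 : κ ^ 3 * N ≤ H2) (hN : 1 / 2 ≤ N * ι) (hN' : N * ι ≤ 1)
    (hYN : Y ^ 2 = N) (hG : |G| ≤ κ * C4 * X * (ι * Y)) (hdd : |dd| ≤ κ * C5)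
    (hB : 0 < B) (hιB : 1 ≤ ι * B)
    (ht0 : t0 = 1 + 2 * (C4 ^ 2 + 2 * C5 ^ 2) + 2 * (1 + 4 * Λ ^ 2) * B ^ 2)
    (ht : t0 ≤ τ * κ0) :
    (1 + 4 * Λ ^ 2) * z ^ 2 ≤
      2 * τ * H + 2 * τ * z * G + 2 * τ ^ 3 * H2 * z ^ 2 - 2 * τ ^ 2 * dd ^ 2 * z ^ 2 := by
  obtain ⟨t, rfl⟩ : ∃ t, κ = t * ι / τ := ⟨τ * κ / ι, by field_simp⟩
  have htt : τ * κ0 ≤ t := by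
    have : κ0 * ι * τ ≤ t * ι := by rw [le_div_iff₀ hτ] at hκ; exact hκ
    nlinarith
  have h1 : 1 ≤ t := by
    nlinarith [sq_nonneg C4, sq_nonneg C5, sq_nonneg Λ, sq_nonneg B,
    mul_nonneg (sq_nonneg Λ) (sq_nonneg B)]
  have h2 : 2 * (C4 ^ 2 + 2 * C5 ^ 2) ≤ t := by
    nlinarith [sq_nonneg Λ, sq_nonneg B, mul_nonneg (sq_nonneg Λ) (sq_nonneg B)]
  have h3 : 2 * (1 + 4 * Λ ^ 2) * B ^ 2 ≤ t := by nlinarith [sq_nonneg C4, sq_nonneg C5]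
  have e1 : 2 * (t * ι) * X ^ 2 ≤ 2 * τ * H := by
    have := mul_le_mul_of_nonneg_left hH (show 0 ≤ 2 * τ by positivity)
    refine le_trans (le_of_eq ?_) this
    field_simp
  have e2 : 2 * t ^ 3 * ι ^ 3 * N * z ^ 2 ≤ 2 * τ ^ 3 * H2 * z ^ 2 := by
    have := mul_le_mul_of_nonneg_left hH2 (show 0 ≤ 2 * τ ^ 3 * z ^ 2 by positivity)
    refine le_trans (le_of_eq ?_) (this.trans (le_of_eq (by ring)))
    field_simp
  have e3 : τ * |G| ≤ t * ι * (C4 * X * (ι * Y)) := by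
    have := mul_le_mul_of_nonneg_left hG hτ.le
    refine this.trans (le_of_eq ?_)
    field_simp
  have e4 : τ ^ 2 * dd ^ 2 ≤ t ^ 2 * ι ^ 2 * C5 ^ 2 := by
    have h5 : dd ^ 2 ≤ (t * ι / τ * C5) ^ 2 := sq_le_sq' (by linarith [abs_le.mp hdd]) (abs_le.mp hdd).2
    have := mul_le_mul_of_nonneg_left h5 (show 0 ≤ τ ^ 2 by positivity)
    refine this.trans (le_of_eq ?_)
    field_simp
  have e5 : -(t * ι * X ^ 2 + t * C4 ^ 2 * ι ^ 2 * z ^ 2) ≤ 2 * τ * z * G := by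
    have a1 : -(2 * |z| * (τ * |G|)) ≤ 2 * τ * z * G := by
      have : |2 * τ * z * G| = 2 * |z| * (τ * |G|) := by
        rw [abs_mul, abs_mul, abs_mul, abs_two, abs_of_pos hτ]; ring
      rw [← this]; exact neg_abs_le _
    have a2 : 2 * |z| * (τ * |G|) ≤ 2 * |z| * (t * ι * (C4 * X * (ι * Y))) :=
      mul_le_mul_of_nonneg_left e3 (by positivity)
    have a3 : 2 * |z| * (C4 * X * (ι * Y)) ≤ X ^ 2 + C4 ^ 2 * (ι ^ 2 * N) * z ^ 2 := by
      rw [← sq_abs z, ← hYN]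
      nlinarith [sq_nonneg (X - C4 * (ι * Y) * |z|)]
    have a4 : ι ^ 2 * N ≤ ι := by nlinarith
    have a5 : C4 ^ 2 * (ι ^ 2 * N) * z ^ 2 ≤ C4 ^ 2 * ι * z ^ 2 := by gcongr
    have a6 : t * ι * (2 * |z| * (C4 * X * (ι * Y))) ≤ t * ι * (X ^ 2 + C4 ^ 2 * ι * z ^ 2) :=
      mul_le_mul_of_nonneg_left (a3.trans (by linarith)) (by positivity)
    linarith
  have e6 : t ^ 3 * ι ^ 2 * z ^ 2 ≤ 2 * t ^ 3 * ι ^ 3 * N * z ^ 2 := by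
    have := mul_le_mul_of_nonneg_left hN (show 0 ≤ 2 * t ^ 3 * ι ^ 2 * z ^ 2 by positivity)
    linarith
  have e7 : 2 * (τ ^ 2 * dd ^ 2) * z ^ 2 ≤ 2 * (t ^ 2 * ι ^ 2 * C5 ^ 2) * z ^ 2 := by gcongr
  have e8 : (1 + 4 * Λ ^ 2) ≤ ι ^ 2 * (t ^ 3 - t * C4 ^ 2 - 2 * t ^ 2 * C5 ^ 2) := by
    have b1 : t ^ 3 / 2 ≤ t ^ 3 - t * C4 ^ 2 - 2 * t ^ 2 * C5 ^ 2 := by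
      have : t * C4 ^ 2 ≤ t ^ 2 * C4 ^ 2 := by
        have : t ≤ t ^ 2 := by nlinarith
        gcongr
      have : t ^ 2 * (2 * (C4 ^ 2 + 2 * C5 ^ 2)) ≤ t ^ 2 * t := by gcongr
      nlinarith
    have b2 : t ≤ t ^ 3 := by nlinarith [sq_nonneg t, mul_nonneg (show 0 ≤ t by linarith) (show 0 ≤ t - 1 by linarith)]
    have b3 : (1 + 4 * Λ ^ 2) * B ^ 2 ≤ t ^ 3 - t * C4 ^ 2 - 2 * t ^ 2 * C5 ^ 2 := by linarith
    have b4 : 1 ≤ (ι * B) ^ 2 := by nlinarith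
    calc (1 + 4 * Λ ^ 2) ≤ (1 + 4 * Λ ^ 2) * (ι * B) ^ 2 := by
          have : 0 ≤ 1 + 4 * Λ ^ 2 := by positivity
          nlinarith
      _ = ι ^ 2 * ((1 + 4 * Λ ^ 2) * B ^ 2) := by ring
      _ ≤ _ := by gcongr
  have e9 := mul_le_mul_of_nonneg_right e8 (sq_nonneg z)
  have e10 : 0 ≤ t * ι * X ^ 2 := by positivity
  linarith


/-- The vector field whose divergence appears in the Carleman estimate. -/
def FF {n : ℕ} (A : Fin n → Fin n → EE n → ℝ) (c : EE n) (δ : ℝ) (k : ℕ) (τ : ℝ) (z : EE n → ℝ)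
    (i : Fin n) (y : EE n) : ℝ :=
  (-2 * τ) * (2 * ((∑ j, beta A c δ k j y * pd j z y) * PP A z i y)
        - beta A c δ k i y * ∑ j, PP A z j y * pd j z y)
  + (-2 * τ ^ 3) * (bb A c δ k y * beta A c δ k i y * (z y * z y))
  + (-2 * τ) * (gg A c δ k y * z y * PP A z i y)

section
variable {n : ℕ} {A : Fin n → Fin n → EE n → ℝ} (hA : ∀ i j, ContDiff ℝ 1 (A i j))
  (hsym : ∀ i j x, A i j x = A j i x)
  (c : EE n) {δ : ℝ} (hδ : 0 < δ) (k : ℕ) (τ : ℝ) {z : EE n → ℝ} (hz : ContDiff ℝ 2 z)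

include hA hδ hz in
lemma contDiff_FF (i : Fin n) : ContDiff ℝ 1 (FF A c δ k τ z i) := by
  have hz1 : ContDiff ℝ 1 z := hz.of_le (by norm_num)
  have h1 := contDiff_beta hA c hδ k
  have h2 := contDiff_bb hA c hδ k
  have h3 := contDiff_gg hA c hδ k
  have h4 := fun i => contDiff_PP hA hz i
  have h5 := fun i => contDiff_pd2 i hz
  unfold FF
  refine ContDiff.add (ContDiff.add ?_ ?_) ?_
  · refine contDiff_const.mul (ContDiff.sub (contDiff_const.mul (ContDiff.mul ?_ (h4 i)))
      ((h1 i).mul ?_))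
    · exact ContDiff.sum fun j _ => (h1 j).mul (h5 j)
    · exact ContDiff.sum fun j _ => (h4 j).mul (h5 j)
  · exact contDiff_const.mul ((h2.mul (h1 i)).mul (hz1.mul hz1))
  · exact contDiff_const.mul ((h3.mul hz1).mul (h4 i))

include hA hsym hδ hz in
/-- the key pointwise identity -/
lemma carleman_identity (x : EE n) :
    -2 * (LL A z x + τ ^ 2 * bb A c δ k x * z x)
        * (τ * (2 * (∑ j, beta A c δ k j x * pd j z x) + gg A c δ k x * z x))
      = (∑ i, pd i (FF A c δ k τ z i) x)
        + 2 * τ * (2 * (∑ i, ∑ j, PP A z i x * pd i (beta A c δ k j) x * pd j z x)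
          - (∑ i, pd i (beta A c δ k i) x) * (∑ j, PP A z j x * pd j z x)
          - (∑ l, beta A c δ k l x * ∑ i, ∑ j, pd l (A i j) x * pd i z x * pd j z x)
          + gg A c δ k x * ∑ j, PP A z j x * pd j z x)
        + 2 * τ * z x * (∑ i, PP A z i x * pd i (gg A c δ k) x)
        + 2 * τ ^ 3 * (bb A c δ k x * (∑ i, pd i (beta A c δ k i) x)
          + (∑ i, beta A c δ k i x * pd i (bb A c δ k) x)
          - gg A c δ k x * bb A c δ k x) * z x ^ 2 := by
  have hz1 : ContDiff ℝ 1 z := hz.of_le (by norm_num)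
  have h1 := contDiff_beta hA c hδ k
  have h2 := contDiff_bb hA c hδ k
  have h3 := contDiff_gg hA c hδ k
  have h4 := fun i => contDiff_PP hA hz i
  have h5 := fun i => contDiff_pd2 i hz
  have d1 := div_identity1 hA hsym h1 hz x
  have d2 := div_identity2 h1 h2 hz x
  have d3 := div_identity3 hA h3 hz1 hz x
  have c1 : ∀ i, ContDiff ℝ 1 (fun y => 2 * ((∑ j, beta A c δ k j y * pd j z y) * PP A z i y)
        - beta A c δ k i y * ∑ j, PP A z j y * pd j z y) := by
    intro i
    refine (ContDiff.sub (contDiff_const.mul (ContDiff.mul ?_ (h4 i)))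
      ((h1 i).mul ?_))
    · exact ContDiff.sum fun j _ => (h1 j).mul (h5 j)
    · exact ContDiff.sum fun j _ => (h4 j).mul (h5 j)
  have c2 : ∀ i, ContDiff ℝ 1 (fun y => bb A c δ k y * beta A c δ k i y * (z y * z y)) :=
    fun i => ((h2.mul (h1 i)).mul (hz1.mul hz1))
  have c3 : ∀ i, ContDiff ℝ 1 (fun y => gg A c δ k y * z y * PP A z i y) :=
    fun i => ((h3.mul hz1).mul (h4 i))
  have D1 := fun i => (c1 i).differentiable (by norm_num) x
  have D2 := fun i => (c2 i).differentiable (by norm_num) x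
  have D3 := fun i => (c3 i).differentiable (by norm_num) x
  have hF : ∑ i, pd i (FF A c δ k τ z i) x
      = (-2 * τ) * ∑ i, pd i (fun y => 2 * ((∑ j, beta A c δ k j y * pd j z y) * PP A z i y)
        - beta A c δ k i y * ∑ j, PP A z j y * pd j z y) x
      + (-2 * τ ^ 3) * ∑ i, pd i (fun y => bb A c δ k y * beta A c δ k i y * (z y * z y)) x
      + (-2 * τ) * ∑ i, pd i (fun y => gg A c δ k y * z y * PP A z i y) x := by
    rw [Finset.mul_sum, Finset.mul_sum, Finset.mul_sum, ← Finset.sum_add_distrib,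
      ← Finset.sum_add_distrib]
    refine Finset.sum_congr rfl fun i _ => ?_
    unfold FF
    rw [pd_add i (((D1 i).const_mul _).fun_add ((D2 i).const_mul _)) ((D3 i).const_mul _),
      pd_add i ((D1 i).const_mul _) ((D2 i).const_mul _), pd_const_mul i _ (D1 i),
      pd_const_mul i _ (D2 i), pd_const_mul i _ (D3 i)]
  rw [hF, d1, d2, d3]
  ring
end

lemma sum_PP_yy {n : ℕ} {A : Fin n → Fin n → EE n → ℝ} (hsym : ∀ i j x, A i j x = A j i x)
    (c : EE n) (z : EE n → ℝ) (x : EE n) :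
    ∑ i, PP A z i x * yy c i x = ∑ j, pp A c j x * pd j z x := by
  unfold PP pp
  simp_rw [Finset.sum_mul]
  rw [Finset.sum_comm]
  refine Finset.sum_congr rfl fun i _ => Finset.sum_congr rfl fun j _ => ?_
  rw [hsym i j]; ring

set_option maxHeartbeats 8000000 in
theorem carleman_pt (n : ℕ) {lam K D Λ : ℝ} (hlam : 0 < lam) (hK : 0 < K) (hD : 0 < D) :
    ∃ k : ℕ, 1 ≤ k ∧ ∃ τ0 : ℝ, 0 < τ0 ∧ ∀ (A : Fin n → Fin n → EE n → ℝ),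
      (∀ i j, ContDiff ℝ 1 (A i j)) → (∀ i j x, A i j x = A j i x) →
      ∀ (c : EE n) (δ : ℝ), 0 < δ → δ ≤ 1 → ∀ z : EE n → ℝ, ContDiff ℝ 2 z →
      ∀ (x : EE n) (τ : ℝ), τ0 ≤ τ → (∀ i j, |A i j x| ≤ K) → (∀ l i j, |pd l (A i j) x| ≤ K) →
      (∀ ξ : Fin n → ℝ, lam * ∑ i, ξ i ^ 2 ≤ ∑ i, (∑ j, A i j x * ξ j) * ξ i) →
      δ ≤ NN c x → NN c x ≤ D ^ 2 →
      (1 + 4 * Λ ^ 2) * z x ^ 2 + ∑ i, pd i (FF A c δ k τ z i) x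
        ≤ ((LL A z x + τ ^ 2 * bb A c δ k x * z x)
            - (τ * (2 * (∑ j, beta A c δ k j x * pd j z x) + gg A c δ k x * z x))) ^ 2
          - 2 * τ ^ 2 * ((∑ i, pd i (beta A c δ k i) x) - gg A c δ k x) ^ 2 * z x ^ 2 := by
  set C1 : ℝ := (n * (n * (K * D) + K) * (n * n * K) + 2 * (n * n * (n * K * (n * (K * D) + K)))
        + n * (n * K * D * (n * n * K))) with hC1
  set C2 : ℝ := (n * n * K * (n * (n * (K * D) + K))
        + n * (n * K * (n * (n * (K * D) + K) + n * K))) with hC2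
  obtain ⟨k, hk⟩ := exists_nat_ge ((C1 + C2 + 1) / lam ^ 2 + 1)
  have hC1p : 0 ≤ C1 := by positivity
  have hC2p : 0 ≤ C2 := by positivity
  have hk1 : (1 : ℝ) ≤ k := by
    have : 0 ≤ (C1 + C2 + 1) / lam ^ 2 := by positivity
    linarith
  have hk2 : C1 + C2 + 1 ≤ (k + 1) * lam ^ 2 := by
    have : (C1 + C2 + 1) / lam ^ 2 ≤ k + 1 := by linarith
    rwa [div_le_iff₀ (by positivity)] at this
  set B : ℝ := D ^ 2 + 1 with hB
  have hBp : 0 < B := by positivity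
  set κ0 : ℝ := 2 * k / B ^ k with hκ0
  have hκ0p : 0 < κ0 := by positivity
  set Cde : ℝ := (n * (n * (K * D) + K) + n * K) with hCde
  set C4 : ℝ := n * (n * K * (4 * (k + 1) * (Cde + (2 * k + 4) * (n * n * K)))) with hC4
  set C5 : ℝ := 2 * (k + 1) * (n * n * K) + n * (n * (K * D) + K) with hC5
  set t0 : ℝ := 1 + 2 * (C4 ^ 2 + 2 * C5 ^ 2) + 2 * (1 + 4 * Λ ^ 2) * B ^ 2 with ht0
  have ht0p : 0 < t0 := by positivity
  refine ⟨k, by exact_mod_cast hk1, t0 / κ0, by positivity, ?_⟩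
  intro A hA hsym c δ hδ hδ1 z hz x τ hτ ha hda hell hδN hND
  have hτp : 0 < τ := lt_of_lt_of_le (by positivity) hτ
  have htτ : t0 ≤ τ * κ0 := by rwa [div_le_iff₀ hκ0p] at hτ
  -- abbreviations
  set N := NN c x with hN
  have hNp : 0 < N := lt_of_lt_of_le hδ hδN
  set ι := iot c δ x with hι
  have hιe : ι = (N + δ)⁻¹ := rfl
  have hιp : 0 < ι := by rw [hιe]; positivity
  have hι1 : ι * (N + δ) = 1 := by rw [hιe]; exact inv_mul_cancel₀ (by positivity)
  have hιs : N * ι + ι * δ = 1 := by rw [← hι1]; ring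
  have hιδ0 : 0 < ι * δ := mul_pos hιp hδ
  have hιδN : ι * δ ≤ N * ι := by
    rw [mul_comm N]; exact mul_le_mul_of_nonneg_left hδN hιp.le
  have hNι : N * ι ≤ 1 := by linarith only [hιs, hιδ0]
  have hNι2 : 1 / 2 ≤ N * ι := by linarith only [hιs, hιδN]
  have hιB : 1 ≤ ι * B := by
    have h0 : ι * (N + δ) ≤ ι * B := mul_le_mul_of_nonneg_left (by linarith) hιp.le
    linarith
  set κ := kap c δ k x with hκ
  have hκe : κ = 2 * k * ι ^ (k + 1) := rfl
  have hκp : 0 < κ := by rw [hκe]; positivity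
  have hκι : κ0 * ι ≤ κ := by
    have h1 : 1 ≤ ι ^ k * B ^ k := by rw [← mul_pow]; exact one_le_pow₀ hιB
    rw [hκe, hκ0, pow_succ]
    have : 2 * (k : ℝ) / B ^ k ≤ 2 * k * ι ^ k := by
      rw [div_le_iff₀ (by positivity)]
      have h5 : 2 * (k : ℝ) * 1 ≤ 2 * k * (ι ^ k * B ^ k) :=
        mul_le_mul_of_nonneg_left h1 (by positivity)
      linarith only [h5]
    have h6 := mul_le_mul_of_nonneg_right this hιp.le
    linarith only [h6]
  set m := mm c δ k x with hm
  have hme : m = 2 * (k + 1) * ι := rfl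
  set e := ee A c x with he
  set Y := Real.sqrt N with hY
  have hY2 : Y ^ 2 = N := Real.sq_sqrt hNp.le
  have hYp : 0 ≤ Y := Real.sqrt_nonneg _
  have hYD : Y ≤ D := by
    rw [hY]; exact Real.sqrt_le_iff.mpr ⟨hD.le, hND⟩
  have hyb : ∀ i, |yy c i x| ≤ Y := by
    intro i
    apply Real.abs_le_sqrt
    rw [hN]; unfold NN
    have := Finset.single_le_sum (f := fun j => yy c j x * yy c j x)
      (fun j _ => mul_self_nonneg _) (Finset.mem_univ i)
    simpa [sq] using this
  set X := Real.sqrt (∑ i, pd i z x ^ 2) with hX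
  have hX2 : X ^ 2 = ∑ i, pd i z x ^ 2 := Real.sq_sqrt (Finset.sum_nonneg fun i _ => sq_nonneg _)
  have hXp : 0 ≤ X := Real.sqrt_nonneg _
  have hXb : ∀ i, |pd i z x| ≤ X := by
    intro i
    apply Real.abs_le_sqrt
    exact Finset.single_le_sum (f := fun j => pd j z x ^ 2)
      (fun j _ => sq_nonneg _) (Finset.mem_univ i)
  -- ellipticity consequences
  set Q0 := ∑ j, PP A z j x * pd j z x with hQ0
  have hQ0l : lam * X ^ 2 ≤ Q0 := by
    rw [hX2]; exact hell (fun i => pd i z x)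
  have hel : lam * N ≤ e := by
    have := hell (fun i => yy c i x)
    have h2 : ∑ i, yy c i x ^ 2 = N := by
      rw [hN]; unfold NN; exact Finset.sum_congr rfl fun i _ => sq _
    rw [h2] at this
    exact this
  have hep : 0 < e := lt_of_lt_of_le (by positivity) hel
  have heu : e ≤ n * n * K * N := by
    have := (le_abs_self _).trans (ee_bound (c := c) ha hyb)
    rw [← hY2]; refine this.trans (le_of_eq (by ring))
  have hιe2 : ι * e ≤ n * n * K := by
    calc ι * e ≤ ι * (n * n * K * N) := by gcongr
      _ = n * n * K * (N * ι) := by ring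
      _ ≤ n * n * K * 1 := by gcongr
      _ = n * n * K := by ring
  have hmel : (k + 1) * lam ≤ m * e := by
    rw [hme]
    have h3 : lam * (1 / 2) ≤ ι * e := by
      have h4 := mul_le_mul_of_nonneg_left hel hιp.le
      have h5 := mul_le_mul_of_nonneg_left hNι2 hlam.le
      linarith only [h4, h5]
    have h6 := mul_le_mul_of_nonneg_left h3 (show (0:ℝ) ≤ 2 * (k + 1) by positivity)
    linarith only [h6]
  have hmp : 0 < m := by rw [hme]; positivity
  -- H1
  set S := ∑ j, pp A c j x * pd j z x with hS
  set dv := ∑ i, pd i (pp A c i) x with hdv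
  have hdivb : ∑ i, pd i (beta A c δ k i) x = κ * (m * e - dv) := by
    simp_rw [pd_beta hA c hδ k]
    rw [← Finset.mul_sum, Finset.sum_sub_distrib]
    congr 2
    rw [he]; unfold ee; rw [Finset.mul_sum]
    exact Finset.sum_congr rfl fun i _ => by ring
  have hgg : gg A c δ k x = 2 * (κ * (m * e)) := rfl
  have hbb : bb A c δ k x = κ * κ * e := rfl
  set R1 := dv * Q0 - 2 * (∑ i, ∑ j, PP A z i x * pd i (pp A c j) x * pd j z x)
      + ∑ l, pp A c l x * ∑ i, ∑ j, pd l (A i j) x * pd i z x * pd j z x with hR1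
  have hR1b : |R1| ≤ C1 * X ^ 2 := rem1_bound hA ha hda hyb hYD hK.le hXb
  have hH : 2 * (∑ i, ∑ j, PP A z i x * pd i (beta A c δ k j) x * pd j z x)
          - (∑ i, pd i (beta A c δ k i) x) * Q0
          - (∑ l, beta A c δ k l x * ∑ i, ∑ j, pd l (A i j) x * pd i z x * pd j z x)
          + gg A c δ k x * Q0 = κ * (m * e * Q0 + 2 * m * S ^ 2 + R1) := by
    rw [hdivb, hgg]
    have h1 : ∑ i, ∑ j, PP A z i x * pd i (beta A c δ k j) x * pd j z x
        = κ * (m * S * S) - κ * (∑ i, ∑ j, PP A z i x * pd i (pp A c j) x * pd j z x) := by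
      simp_rw [pd_beta hA c hδ k]
      have h2 : S * S = ∑ i, ∑ j, (PP A z i x * yy c i x) * (pp A c j x * pd j z x) := by
        rw [← Finset.sum_mul_sum, sum_PP_yy hsym]
      have h3 : κ * (m * S * S) = ∑ i, ∑ j, κ * m * ((PP A z i x * yy c i x) * (pp A c j x * pd j z x)) := by
        rw [mul_assoc m, h2]; simp_rw [Finset.mul_sum]
        exact Finset.sum_congr rfl fun i _ => Finset.sum_congr rfl fun j _ => by ring
      rw [h3]
      simp_rw [Finset.mul_sum]
      rw [← Finset.sum_sub_distrib]
      refine Finset.sum_congr rfl fun i _ => ?_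
      rw [← Finset.sum_sub_distrib]
      exact Finset.sum_congr rfl fun j _ => by ring
    have h4 : ∑ l, beta A c δ k l x * ∑ i, ∑ j, pd l (A i j) x * pd i z x * pd j z x
        = - (κ * ∑ l, pp A c l x * ∑ i, ∑ j, pd l (A i j) x * pd i z x * pd j z x) := by
      rw [Finset.mul_sum, ← Finset.sum_neg_distrib]
      refine Finset.sum_congr rfl fun l _ => ?_
      unfold beta; ring
    rw [h1, h4, hR1]; ring
  have hH1 : κ * X ^ 2 ≤ κ * (m * e * Q0 + 2 * m * S ^ 2 + R1) := by
    refine mul_le_mul_of_nonneg_left ?_ hκp.le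
    have h1 : (k + 1) * lam * (lam * X ^ 2) ≤ m * e * Q0 := by gcongr
    have h2 : 0 ≤ 2 * m * S ^ 2 := by positivity
    have h3 := (abs_le.mp hR1b).1
    have h4 : (C1 + C2 + 1) * X ^ 2 ≤ (k + 1) * lam ^ 2 * X ^ 2 := by gcongr
    have h5 : 0 ≤ C2 * X ^ 2 := by positivity
    linarith
  -- H2
  set R2 := e * dv + ∑ i, pp A c i x * pd i (ee A c) x with hR2
  have hR2b : |R2| ≤ C2 * Y ^ 2 := rem2_bound hA ha hda hyb hYD hK.le
  have hH2 : bb A c δ k x * (∑ i, pd i (beta A c δ k i) x)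
          + (∑ i, beta A c δ k i x * pd i (bb A c δ k) x)
          - gg A c δ k x * bb A c δ k x = κ ^ 3 * (m * e ^ 2 - R2) := by
    rw [hdivb, hgg, hbb]
    have h1 : ∑ i, beta A c δ k i x * pd i (bb A c δ k) x
        = κ ^ 3 * (2 * m * e * e) - κ ^ 3 * ∑ i, pp A c i x * pd i (ee A c) x := by
      simp_rw [pd_bb hA c hδ k]
      have h3 : κ ^ 3 * (2 * m * e * e) = ∑ i, κ ^ 3 * (2 * m * e) * (pp A c i x * yy c i x) := by
        rw [← Finset.mul_sum]
        have : ∑ i, pp A c i x * yy c i x = e := rfl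
        rw [this]; ring
      rw [h3, Finset.mul_sum, ← Finset.sum_sub_distrib]
      refine Finset.sum_congr rfl fun l _ => ?_
      unfold beta; ring
    rw [h1, hR2]; ring
  have hH2' : κ ^ 3 * N ≤ κ ^ 3 * (m * e ^ 2 - R2) := by
    refine mul_le_mul_of_nonneg_left ?_ (by positivity)
    have h1 : (k + 1) * lam * (lam * N) ≤ m * e * e := by gcongr
    have h3 := (abs_le.mp hR2b).2
    rw [hY2] at h3
    have h4 : (C1 + C2 + 1) * N ≤ (k + 1) * lam ^ 2 * N := by gcongr
    have h5 : 0 ≤ C1 * N := by positivity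
    linarith only [h1, h3, h4, h5]
  -- G
  have hG : |∑ i, PP A z i x * pd i (gg A c δ k) x| ≤ κ * C4 * X * (ι * Y) := by
    have hg1 : ∀ i, |pd i (gg A c δ k) x|
        ≤ κ * (4 * (k + 1)) * (Cde + (2 * k + 4) * (n * n * K)) * (ι * Y) := by
      intro i
      rw [pd_gg hA c hδ k]
      have h1 : |pd i (ee A c) x| ≤ Cde * Y := dee_bound hA ha hda hyb hYD hK.le i
      have h2 : |(m + 2 * ι) * yy c i x * e| ≤ (2 * k + 4) * (n * n * K) * Y := by
        have h6 : (m + 2 * ι) * yy c i x * e = (2 * k + 4) * (ι * e) * yy c i x := by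
          rw [hme]; ring
        rw [h6]
        refine abs_mul_le' ?_ (hyb i)
        rw [abs_of_nonneg (by positivity)]
        gcongr
      have h3 : |pd i (ee A c) x - (m + 2 * ι) * yy c i x * e|
          ≤ Cde * Y + (2 * k + 4) * (n * n * K) * Y := (abs_sub _ _).trans (add_le_add h1 h2)
      calc |2 * κ * m * (pd i (ee A c) x - (m + 2 * ι) * yy c i x * e)|
          ≤ (2 * κ * m) * (Cde * Y + (2 * k + 4) * (n * n * K) * Y) := by
            refine abs_mul_le' ?_ h3
            rw [abs_of_nonneg (by positivity)]
        _ = _ := by rw [hme]; ring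
    have h7 := abs_sum_le' (n := n) fun i => abs_mul_le' (PP_bound ha hXb i) (hg1 i)
    refine h7.trans (le_of_eq ?_)
    rw [hC4]; ring
  have hdd : |(∑ i, pd i (beta A c δ k i) x) - gg A c δ k x| ≤ κ * C5 := by
    rw [hdivb, hgg]
    have h1 : κ * (m * e - dv) - 2 * (κ * (m * e)) = κ * (-(m * e) - dv) := by ring
    rw [h1]
    refine abs_mul_le' (le_of_eq (abs_of_pos hκp)) ?_
    refine (abs_sub _ _).trans (add_le_add ?_ (sum_dpp_bound hA ha hda hyb hYD hK.le))
    rw [abs_neg, abs_of_pos (by positivity), hme]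
    calc 2 * (k + 1) * ι * e = 2 * (k + 1) * (ι * e) := by ring
      _ ≤ _ := by gcongr
  have hid := carleman_identity hA hsym c hδ k τ hz x
  have hsc := carleman_scalar (z := z x) (Λ := Λ) hτp hκ0p hιp hκι hH1 hH2' hNι2 hNι hY2 hG hdd hBp hιB
    ht0 htτ
  rw [← hQ0, hH, hH2] at hid
  have hsq := add_nonneg (sq_nonneg (LL A z x + τ ^ 2 * bb A c δ k x * z x))
    (sq_nonneg (τ * (2 * (∑ j, beta A c δ k j x * pd j z x) + gg A c δ k x * z x)))
  rw [sub_sq]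
  linarith


/-- radial cutoff composed with squared distance -/
def RX {n : ℕ} (X : ℝ → ℝ) (c : EE n) (x : EE n) : ℝ := X (NN c x)

/-- the exponential weight -/
def EW {n : ℕ} (c : EE n) (δ : ℝ) (k : ℕ) (τ : ℝ) (x : EE n) : ℝ := Real.exp (τ * iot c δ x ^ k)

lemma contDiff_RX {n : ℕ} {a : WithTop ℕ∞} {X : ℝ → ℝ} (hX : ContDiff ℝ a X) (c : EE n) :
    ContDiff ℝ a (RX X c) := by
  unfold RX; exact hX.comp (contDiff_NN c)

lemma pd_RX {n : ℕ} {X : ℝ → ℝ} (hX : ContDiff ℝ 1 X) (c : EE n) (i : Fin n) (x : EE n) :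
    pd i (RX X c) x = deriv X (NN c x) * (2 * yy c i x) := by
  unfold RX
  rw [pd_comp i (hX.differentiable (by norm_num) _)
    ((contDiff_NN c (a := 1)).differentiable (by norm_num) _), pd_NN]

lemma PP_RX {n : ℕ} (A : Fin n → Fin n → EE n → ℝ) {X : ℝ → ℝ} (hX : ContDiff ℝ 1 X) (c : EE n)
    (i : Fin n) (x : EE n) :
    PP A (RX X c) i x = 2 * (deriv X (NN c x) * pp A c i x) := by
  unfold PP pp
  simp_rw [pd_RX hX, Finset.mul_sum]
  exact Finset.sum_congr rfl fun j _ => by ring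

lemma LL_RX {n : ℕ} {A : Fin n → Fin n → EE n → ℝ} (hA : ∀ i j, ContDiff ℝ 1 (A i j))
    {X : ℝ → ℝ} (hX : ContDiff ℝ 2 X) (c : EE n) (x : EE n) :
    LL A (RX X c) x = 2 * deriv X (NN c x) * (∑ i, pd i (pp A c i) x)
      + 4 * deriv (deriv X) (NN c x) * ee A c x := by
  have hX1 : ContDiff ℝ 1 X := hX.of_le (by norm_num)
  have hX2 : ContDiff ℝ 1 (deriv X) := by
    have : ContDiff ℝ (1 + 1) X := by norm_num; exact hX
    exact (contDiff_succ_iff_deriv.mp this).2.2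
  unfold LL ee
  have h1 : ∀ i, pd i (PP A (RX X c) i) x = 2 * (deriv (deriv X) (NN c x) * (2 * yy c i x) * pp A c i x
      + deriv X (NN c x) * pd i (pp A c i) x) := by
    intro i
    have h2 : PP A (RX X c) i = fun y => 2 * (RX (deriv X) c y * pp A c i y) := by
      funext y; exact PP_RX A hX1 c i y
    have d1 : DifferentiableAt ℝ (RX (deriv X) c) x :=
      (contDiff_RX hX2 c).differentiable (by norm_num) x
    have d2 : DifferentiableAt ℝ (pp A c i) x := (contDiff_pp hA c i).differentiable (by norm_num) x
    rw [h2, pd_const_mul i _ (d1.fun_mul d2), pd_mul i d1 d2, pd_RX hX2]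
    rfl
  simp_rw [h1, Finset.mul_sum]
  rw [← Finset.sum_add_distrib]
  exact Finset.sum_congr rfl fun j _ => by ring

lemma contDiff_EW {n : ℕ} {a : WithTop ℕ∞} (c : EE n) {δ : ℝ} (hδ : 0 < δ) (k : ℕ) (τ : ℝ) :
    ContDiff ℝ a (EW c δ k τ) := by
  unfold EW
  exact (contDiff_const.mul ((contDiff_iot c hδ).pow k)).exp

lemma pd_EW {n : ℕ} (c : EE n) {δ : ℝ} (hδ : 0 < δ) {k : ℕ} (hk : 1 ≤ k) (τ : ℝ) (i : Fin n)
    (x : EE n) : pd i (EW c δ k τ) x = - (τ * EW c δ k τ x * (kap c δ k x * yy c i x)) := by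
  have d1 : DifferentiableAt ℝ (fun y => iot c δ y ^ k) x :=
    ((contDiff_iot c hδ (a := 1)).pow k).differentiable (by norm_num) x
  unfold EW
  rw [pd_comp i (h := Real.exp) (f := fun y => τ * iot c δ y ^ k) Real.differentiableAt_exp
    (d1.const_mul _), pd_const_mul i _ d1, pd_phi c hδ k hk, Real.deriv_exp]
  ring

lemma PP_EW {n : ℕ} (A : Fin n → Fin n → EE n → ℝ) (c : EE n) {δ : ℝ} (hδ : 0 < δ) {k : ℕ}
    (hk : 1 ≤ k) (τ : ℝ) (i : Fin n) (x : EE n) :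
    PP A (EW c δ k τ) i x = τ * (EW c δ k τ x * beta A c δ k i x) := by
  unfold PP beta pp
  simp_rw [pd_EW c hδ hk, Finset.mul_sum, ← Finset.sum_neg_distrib, Finset.mul_sum]
  exact Finset.sum_congr rfl fun j _ => by ring

lemma sum_beta_EW {n : ℕ} (A : Fin n → Fin n → EE n → ℝ) (c : EE n) {δ : ℝ} (hδ : 0 < δ) {k : ℕ}
    (hk : 1 ≤ k) (τ : ℝ) (x : EE n) :
    ∑ i, beta A c δ k i x * pd i (EW c δ k τ) x = τ * EW c δ k τ x * bb A c δ k x := by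
  unfold beta bb ee
  simp_rw [pd_EW c hδ hk, Finset.mul_sum]
  exact Finset.sum_congr rfl fun j _ => by ring

lemma LL_EW {n : ℕ} {A : Fin n → Fin n → EE n → ℝ} (hA : ∀ i j, ContDiff ℝ 1 (A i j))
    (c : EE n) {δ : ℝ} (hδ : 0 < δ) {k : ℕ} (hk : 1 ≤ k) (τ : ℝ) (x : EE n) :
    LL A (EW c δ k τ) x = τ * EW c δ k τ x * (∑ i, pd i (beta A c δ k i) x)
      + τ ^ 2 * EW c δ k τ x * bb A c δ k x := by
  unfold LL
  have h1 : ∀ i, pd i (PP A (EW c δ k τ) i) x = τ * EW c δ k τ x * pd i (beta A c δ k i) x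
      + τ * (beta A c δ k i x * pd i (EW c δ k τ) x) := by
    intro i
    have h2 : PP A (EW c δ k τ) i = fun y => τ * (EW c δ k τ y * beta A c δ k i y) := by
      funext y; exact PP_EW A c hδ hk τ i y
    have d1 : DifferentiableAt ℝ (EW c δ k τ) x :=
      (contDiff_EW c hδ k τ (a := 1)).differentiable (by norm_num) x
    have d2 : DifferentiableAt ℝ (beta A c δ k i) x :=
      (contDiff_beta hA c hδ k i).differentiable (by norm_num) x
    rw [h2, pd_const_mul i _ (d1.fun_mul d2), pd_mul i d1 d2]
    ring
  simp_rw [h1]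
  rw [Finset.sum_add_distrib, ← Finset.mul_sum, ← Finset.mul_sum, sum_beta_EW A c hδ hk]
  ring

lemma conj_identity {n : ℕ} {A : Fin n → Fin n → EE n → ℝ} (hA : ∀ i j, ContDiff ℝ 1 (A i j))
    (hsym : ∀ i j x, A i j x = A j i x)
    (c : EE n) {δ : ℝ} (hδ : 0 < δ) {k : ℕ} (hk : 1 ≤ k) (τ : ℝ) {w : EE n → ℝ}
    (hw : ContDiff ℝ 2 w) (x : EE n) :
    (LL A (fun y => EW c δ k τ y * w y) x + τ ^ 2 * bb A c δ k x * (EW c δ k τ x * w x))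
            - (τ * (2 * (∑ j, beta A c δ k j x * pd j (fun y => EW c δ k τ y * w y) x)
              + gg A c δ k x * (EW c δ k τ x * w x)))
      = EW c δ k τ x * LL A w x
        + τ * ((∑ i, pd i (beta A c δ k i) x) - gg A c δ k x) * (EW c δ k τ x * w x) := by
  have hE : ContDiff ℝ 2 (EW c δ k τ) := contDiff_EW c hδ k τ
  rw [LL_mul hA hsym hE hw, LL_EW hA c hδ hk]
  have h1 : ∑ j, beta A c δ k j x * pd j (fun y => EW c δ k τ y * w y) x
      = τ * EW c δ k τ x * bb A c δ k x * w x + EW c δ k τ x * ∑ j, beta A c δ k j x * pd j w x := by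
    rw [← sum_beta_EW A c hδ hk, Finset.sum_mul, Finset.mul_sum, ← Finset.sum_add_distrib]
    refine Finset.sum_congr rfl fun j _ => ?_
    rw [pd_mul j (hE.differentiable (by norm_num) x) (hw.differentiable (by norm_num) x)]
    ring
  have h2 : ∑ i, PP A (EW c δ k τ) i x * pd i w x
      = τ * EW c δ k τ x * ∑ j, beta A c δ k j x * pd j w x := by
    rw [Finset.mul_sum]
    refine Finset.sum_congr rfl fun j _ => ?_
    rw [PP_EW A c hδ hk]; ring
  rw [h1, h2]; ring

/-- the commutator term -/
def cmt {n : ℕ} (A : Fin n → Fin n → EE n → ℝ) (c : EE n) (u : EE n → ℝ) (X1 X2 : ℝ) (x : EE n) : ℝ :=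
  4 * X1 * (∑ i, pp A c i x * pd i u x)
    + u x * (2 * X1 * (∑ i, pd i (pp A c i) x) + 4 * X2 * ee A c x)

lemma cmt_sub {n : ℕ} (A : Fin n → Fin n → EE n → ℝ) (c : EE n) (u : EE n → ℝ)
    (X1 X2 Y1 Y2 : ℝ) (x : EE n) :
    cmt A c u (X1 - Y1) (X2 - Y2) x = cmt A c u X1 X2 x - cmt A c u Y1 Y2 x := by
  unfold cmt; ring

lemma cmt_zero {n : ℕ} (A : Fin n → Fin n → EE n → ℝ) (c : EE n) (u : EE n → ℝ) (x : EE n) :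
    cmt A c u 0 0 x = 0 := by
  unfold cmt; ring

lemma LL_cut {n : ℕ} {A : Fin n → Fin n → EE n → ℝ} (hA : ∀ i j, ContDiff ℝ 1 (A i j))
    (hsym : ∀ i j x, A i j x = A j i x) {X : ℝ → ℝ} (hX : ContDiff ℝ 2 X) (c : EE n)
    {u : EE n → ℝ} (hu : ContDiff ℝ 2 u) (x : EE n) :
    LL A (fun y => RX X c y * u y) x = RX X c x * LL A u x
      + cmt A c u (deriv X (NN c x)) (deriv (deriv X) (NN c x)) x := by
  rw [LL_mul hA hsym (contDiff_RX hX c) hu, LL_RX hA hX]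
  simp_rw [PP_RX A (hX.of_le (by norm_num) : ContDiff ℝ 1 X)]
  unfold cmt
  have : ∑ i, 2 * (deriv X (NN c x) * pp A c i x) * pd i u x
      = 2 * deriv X (NN c x) * ∑ i, pp A c i x * pd i u x := by
    rw [Finset.mul_sum]; exact Finset.sum_congr rfl fun j _ => by ring
  rw [this]; ring

/-- bound of the commutator -/
lemma cmt_bound {n : ℕ} {A : Fin n → Fin n → EE n → ℝ} (hA : ∀ i j, ContDiff ℝ 1 (A i j))
    {c x : EE n} {K D : ℝ} (hK : 0 ≤ K) (hD : 0 ≤ D)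
    (ha : ∀ i j, |A i j x| ≤ K) (hda : ∀ k i j, |pd k (A i j) x| ≤ K)
    (hy : ∀ i, |yy c i x| ≤ D) (u : EE n → ℝ) {X1 X2 T : ℝ} (h1 : |X1| ≤ T) (h2 : |X2| ≤ T) :
    cmt A c u X1 X2 x ^ 2
      ≤ 2 * (T * (4 * (n * (K * D)) * n + 2 * (n * (n * (K * D) + K)) + 4 * (n * (n * (K * D) * D)))) ^ 2
        * (u x ^ 2 + ∑ i, pd i u x ^ 2) := by
  set U := Real.sqrt (∑ i, pd i u x ^ 2) with hU
  have hU2 : U ^ 2 = ∑ i, pd i u x ^ 2 := Real.sq_sqrt (Finset.sum_nonneg fun i _ => sq_nonneg _)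
  have hUb : ∀ i, |pd i u x| ≤ U := by
    intro i
    apply Real.abs_le_sqrt
    exact Finset.single_le_sum (f := fun j => pd j u x ^ 2)
      (fun j _ => sq_nonneg _) (Finset.mem_univ i)
  have hU0 : 0 ≤ U := Real.sqrt_nonneg _
  have hT : 0 ≤ T := (abs_nonneg _).trans h1
  clear_value U
  have b1 := abs_sum_le' (n := n) fun i => abs_mul_le' (pp_bound ha hy i) (hUb i)
  have b2 := sum_dpp_bound hA ha hda hy le_rfl hK
  have b3 := ee_bound ha hy
  set P := n * (K * D) with hP
  set Q := (n : ℝ) * (n * (K * D) + K) with hQ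
  set Z := n * (n * (K * D) * D) with hZ
  have hP0 : 0 ≤ P := by positivity
  have hQ0 : 0 ≤ Q := by positivity
  have hZ0 : 0 ≤ Z := by positivity
  clear_value P Q Z
  have e1 : |4 * X1 * (∑ i, pp A c i x * pd i u x)| ≤ (4 * T) * (n * (P * U)) := by
    refine abs_mul_le' ?_ b1
    rw [abs_mul, abs_of_pos (by norm_num : (0:ℝ) < 4)]; gcongr
  have e2 : |2 * X1 * (∑ i, pd i (pp A c i) x) + 4 * X2 * ee A c x| ≤ 2 * T * Q + 4 * T * Z := by
    refine (abs_add_le _ _).trans (add_le_add (abs_mul_le' ?_ b2) (abs_mul_le' ?_ b3))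
    · rw [abs_mul, abs_of_pos (by norm_num : (0:ℝ) < 2)]; gcongr
    · rw [abs_mul, abs_of_pos (by norm_num : (0:ℝ) < 4)]; gcongr
  have e3 : |cmt A c u X1 X2 x| ≤ (4 * T) * (n * (P * U)) + |u x| * (2 * T * Q + 4 * T * Z) := by
    unfold cmt
    exact (abs_add_le _ _).trans (add_le_add e1 (abs_mul_le' le_rfl e2))
  set W := T * (4 * P * n + 2 * Q + 4 * Z) with hW
  have e4 : (4 * T) * (n * (P * U)) + |u x| * (2 * T * Q + 4 * T * Z) ≤ W * (|u x| + U) := by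
    have f1 : (4 * T) * (n * (P * U)) ≤ W * U := by
      have : 0 ≤ T * (2 * Q + 4 * Z) * U := by positivity
      rw [hW]; linarith
    have f2 : |u x| * (2 * T * Q + 4 * T * Z) ≤ W * |u x| := by
      have : 0 ≤ T * (4 * P * n) * |u x| := by positivity
      rw [hW]; linarith
    linarith
  have e5 := sq_le_sq' (by linarith [abs_nonneg (cmt A c u X1 X2 x), e3.trans e4]) (e3.trans e4)
  rw [sq_abs] at e5
  rw [← hU2]
  have e6 : (W * (|u x| + U)) ^ 2 ≤ 2 * W ^ 2 * (u x ^ 2 + U ^ 2) := by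
    have := mul_le_mul_of_nonneg_left (add_sq_le (a := |u x|) (b := U)) (sq_nonneg W)
    rw [sq_abs] at this
    linarith
  exact e5.trans e6


lemma st_deriv_zero {t : ℝ} (ht : t < 0 ∨ 1 < t) :
    deriv Real.smoothTransition t = 0 ∧ deriv (deriv Real.smoothTransition) t = 0 := by
  have h1 : ∀ t : ℝ, t < 0 ∨ 1 < t → deriv Real.smoothTransition t = 0 := by
    intro t ht
    rcases ht with ht | ht
    · have : Real.smoothTransition =ᶠ[nhds t] fun _ => (0:ℝ) := by
        filter_upwards [Iio_mem_nhds ht] with y hy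
        exact Real.smoothTransition.zero_of_nonpos (le_of_lt hy)
      rw [this.deriv_eq]; simp
    · have : Real.smoothTransition =ᶠ[nhds t] fun _ => (1:ℝ) := by
        filter_upwards [Ioi_mem_nhds ht] with y hy
        exact Real.smoothTransition.one_of_one_le (le_of_lt hy)
      rw [this.deriv_eq]; simp
  refine ⟨h1 t ht, ?_⟩
  have : deriv Real.smoothTransition =ᶠ[nhds t] fun _ => (0:ℝ) := by
    rcases ht with ht | ht
    · filter_upwards [Iio_mem_nhds ht] with y hy
      exact h1 y (Or.inl hy)
    · filter_upwards [Ioi_mem_nhds ht] with y hy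
      exact h1 y (Or.inr hy)
  rw [this.deriv_eq]; simp

lemma contDiff_deriv1 {X : ℝ → ℝ} (hX : ContDiff ℝ 2 X) : ContDiff ℝ 1 (deriv X) := by
  have : ContDiff ℝ (1 + 1) X := by norm_num; exact hX
  exact (contDiff_succ_iff_deriv.mp this).2.2

lemma st_bound : ∃ S : ℝ, 0 < S ∧ ∀ t, |deriv Real.smoothTransition t| ≤ S ∧
    |deriv (deriv Real.smoothTransition) t| ≤ S := by
  have h2 : ContDiff ℝ 2 Real.smoothTransition := Real.smoothTransition.contDiff
  have h1 := contDiff_deriv1 h2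
  have c1 : Continuous (deriv Real.smoothTransition) := h1.continuous
  have c2 : Continuous (deriv (deriv Real.smoothTransition)) := h1.continuous_deriv le_rfl
  obtain ⟨C, hC⟩ := (isCompact_Icc (a := (0:ℝ)) (b := 1)).exists_bound_of_continuousOn c1.continuousOn
  obtain ⟨C', hC'⟩ := (isCompact_Icc (a := (0:ℝ)) (b := 1)).exists_bound_of_continuousOn c2.continuousOn
  refine ⟨|C| + |C'| + 1, by positivity, fun t => ?_⟩
  by_cases ht : t ∈ Icc (0:ℝ) 1
  · have a1 := hC t ht
    have a2 := hC' t ht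
    rw [Real.norm_eq_abs] at a1 a2
    constructor
    · linarith [le_abs_self C, abs_nonneg C']
    · linarith [le_abs_self C', abs_nonneg C]
  · have : t < 0 ∨ 1 < t := by
      by_contra h; push Not at h; exact ht h
    obtain ⟨e1, e2⟩ := st_deriv_zero this
    rw [e1, e2]; simp; positivity

/-- smooth step from `0` at `b` to `1` at `b + h` -/
def stp (b h t : ℝ) : ℝ := Real.smoothTransition ((t - b) / h)

lemma contDiff_stp {a : ℕ∞} (b h : ℝ) : ContDiff ℝ a (stp b h) := by
  unfold stp
  exact Real.smoothTransition.contDiff.comp ((contDiff_id.sub contDiff_const).div_const _)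

lemma deriv_aff {f : ℝ → ℝ} (hf : Differentiable ℝ f) (b h : ℝ) :
    deriv (fun t => f ((t - b) / h)) = fun t => deriv f ((t - b) / h) / h := by
  funext t
  have h1 : HasDerivAt (fun t : ℝ => (t - b) / h) (1 / h) t :=
    ((hasDerivAt_id t).sub_const b).div_const h
  have := ((hf ((t - b) / h)).hasDerivAt.comp t h1).deriv
  simp only [Function.comp_def] at this
  rw [this]; ring

lemma deriv_stp (b h : ℝ) : deriv (stp b h) = fun t => deriv Real.smoothTransition ((t - b) / h) / h := by
  have h2 : ContDiff ℝ 2 Real.smoothTransition := Real.smoothTransition.contDiff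
  exact deriv_aff (h2.differentiable (by norm_num)) b h

lemma deriv2_stp (b h : ℝ) :
    deriv (deriv (stp b h)) = fun t => deriv (deriv Real.smoothTransition) ((t - b) / h) / h / h := by
  have h2 : ContDiff ℝ 2 Real.smoothTransition := Real.smoothTransition.contDiff
  have h1 := contDiff_deriv1 h2
  rw [deriv_stp]
  have := deriv_aff (h1.differentiable (by norm_num)) b h
  funext t
  have e := congrFun this t
  rw [← e]
  exact deriv_div_const _

lemma stp_zero {b h t : ℝ} (hh : 0 < h) (ht : t ≤ b) : stp b h t = 0 :=
  Real.smoothTransition.zero_of_nonpos (div_nonpos_of_nonpos_of_nonneg (by linarith) hh.le)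

lemma stp_one {b h t : ℝ} (hh : 0 < h) (ht : b + h ≤ t) : stp b h t = 1 :=
  Real.smoothTransition.one_of_one_le (by rw [le_div_iff₀ hh]; linarith)

lemma stp_nonneg (b h t : ℝ) : 0 ≤ stp b h t := Real.smoothTransition.nonneg _
lemma stp_le_one (b h t : ℝ) : stp b h t ≤ 1 := Real.smoothTransition.le_one _

lemma stp_deriv_zero {b h t : ℝ} (hh : 0 < h) (ht : t < b ∨ b + h < t) :
    deriv (stp b h) t = 0 ∧ deriv (deriv (stp b h)) t = 0 := by
  have : (t - b) / h < 0 ∨ 1 < (t - b) / h := by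
    rcases ht with ht | ht
    · left; exact div_neg_of_neg_of_pos (by linarith) hh
    · right; rw [lt_div_iff₀ hh]; linarith
  obtain ⟨e1, e2⟩ := st_deriv_zero this
  rw [deriv2_stp, deriv_stp]
  simp [e1, e2]

lemma stp_deriv_bound {S : ℝ} (hS : ∀ t, |deriv Real.smoothTransition t| ≤ S ∧
    |deriv (deriv Real.smoothTransition) t| ≤ S) {b h : ℝ} (hh : 0 < h) (t : ℝ) :
    |deriv (stp b h) t| ≤ S * h⁻¹ ∧ |deriv (deriv (stp b h)) t| ≤ S * h⁻¹ ^ 2 := by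
  rw [deriv2_stp, deriv_stp]
  obtain ⟨e1, e2⟩ := hS ((t - b) / h)
  constructor
  · simp only []
    rw [div_eq_mul_inv, abs_mul, abs_of_pos (inv_pos.mpr hh)]
    gcongr
  · simp only []
    rw [div_eq_mul_inv, div_eq_mul_inv, mul_assoc, ← sq, abs_mul, abs_of_nonneg (by positivity : 0 ≤ h⁻¹ ^ 2)]
    gcongr

/-- annular cutoff -/
def XX (δ a h t : ℝ) : ℝ := stp δ δ t - stp a h t

lemma contDiff_XX (δ a h : ℝ) : ContDiff ℝ 2 (XX δ a h) := by
  have h1 := contDiff_stp (a := 2) δ δ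
  have h2 := contDiff_stp (a := 2) a h
  unfold XX
  exact_mod_cast ContDiff.sub h1 h2

lemma contDiff_stp2 (b h : ℝ) : ContDiff ℝ 2 (stp b h) := by
  exact_mod_cast contDiff_stp (a := 2) b h

lemma deriv_XX (δ a h : ℝ) : deriv (XX δ a h) = fun t => deriv (stp δ δ) t - deriv (stp a h) t := by
  funext t
  unfold XX
  exact deriv_fun_sub ((contDiff_stp2 δ δ).differentiable (by norm_num) t)
    ((contDiff_stp2 a h).differentiable (by norm_num) t)

lemma deriv2_XX (δ a h : ℝ) : deriv (deriv (XX δ a h))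
    = fun t => deriv (deriv (stp δ δ)) t - deriv (deriv (stp a h)) t := by
  rw [deriv_XX]
  funext t
  exact deriv_fun_sub ((contDiff_deriv1 (contDiff_stp2 δ δ)).differentiable (by norm_num) t)
    ((contDiff_deriv1 (contDiff_stp2 a h)).differentiable (by norm_num) t)

lemma XX_zero {δ a h t : ℝ} (hδ : 0 < δ) (hh : 0 < h) (ha : 2 * δ ≤ a)
    (ht : t ≤ δ ∨ a + h ≤ t) : XX δ a h t = 0 := by
  unfold XX
  rcases ht with ht | ht
  · rw [stp_zero hδ ht, stp_zero hh (by linarith)]; ring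
  · rw [stp_one hδ (by linarith), stp_one hh ht]; ring

lemma XX_one {δ a h t : ℝ} (hδ : 0 < δ) (hh : 0 < h) (ht : 2 * δ ≤ t) (ht' : t ≤ a) :
    XX δ a h t = 1 := by
  unfold XX
  rw [stp_one hδ (by linarith), stp_zero hh ht']; ring


lemma cut_pt {n : ℕ} {A : Fin n → Fin n → EE n → ℝ} (hA : ∀ i j, ContDiff ℝ 1 (A i j))
    (hsym : ∀ i j x, A i j x = A j i x)
    (c : EE n) {δ : ℝ} (hδ : 0 < δ) {k : ℕ} (hk : 1 ≤ k) (τ : ℝ) {X : ℝ → ℝ} (hX : ContDiff ℝ 2 X)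
    {u : EE n → ℝ} (hu : ContDiff ℝ 2 u) {Λ : ℝ} (x : EE n) (hL : |LL A u x| ≤ Λ * |u x|) {dF : ℝ}
    (hC : (1 + 4 * Λ ^ 2) * (EW c δ k τ x * (RX X c x * u x)) ^ 2 + dF
        ≤ ((LL A (fun y => EW c δ k τ y * (RX X c y * u y)) x
              + τ ^ 2 * bb A c δ k x * (EW c δ k τ x * (RX X c x * u x)))
            - (τ * (2 * (∑ j, beta A c δ k j x * pd j (fun y => EW c δ k τ y * (RX X c y * u y)) x)
              + gg A c δ k x * (EW c δ k τ x * (RX X c x * u x))))) ^ 2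
          - 2 * τ ^ 2 * ((∑ i, pd i (beta A c δ k i) x) - gg A c δ k x) ^ 2
            * (EW c δ k τ x * (RX X c x * u x)) ^ 2) :
    (EW c δ k τ x * (RX X c x * u x)) ^ 2 + dF
      ≤ 4 * EW c δ k τ x ^ 2 * cmt A c u (deriv X (NN c x)) (deriv (deriv X) (NN c x)) x ^ 2 := by
  have hw : ContDiff ℝ 2 (fun y => RX X c y * u y) := (contDiff_RX hX c).mul hu
  rw [conj_identity hA hsym c hδ hk τ hw x, LL_cut hA hsym hX c hu] at hC
  generalize cmt A c u (deriv X (NN c x)) (deriv (deriv X) (NN c x)) x = m at *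
  generalize LL A u x = L at *
  generalize (∑ i, pd i (beta A c δ k i) x) - gg A c δ k x = dd at *
  generalize EW c δ k τ x = E at *
  generalize RX X c x = r at *
  generalize u x = v at *
  have hL2 : L ^ 2 ≤ Λ ^ 2 * v ^ 2 := by
    have := sq_le_sq' (by linarith [abs_nonneg L]) hL
    rw [sq_abs, mul_pow, sq_abs] at this
    exact this
  have h1 : (E * (r * L + m) + τ * dd * (E * (r * v))) ^ 2
      ≤ 2 * (E * (r * L + m)) ^ 2 + 2 * (τ * dd * (E * (r * v))) ^ 2 := by
    linarith only [add_sq_le (a := E * (r * L + m)) (b := τ * dd * (E * (r * v)))]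
  have h2 : (r * L + m) ^ 2 ≤ 2 * (r * L) ^ 2 + 2 * m ^ 2 := by
    linarith only [add_sq_le (a := r * L) (b := m)]
  have h3 := mul_le_mul_of_nonneg_left h2 (sq_nonneg E)
  have h4 := mul_le_mul_of_nonneg_left hL2 (mul_nonneg (sq_nonneg E) (sq_nonneg r))
  linarith only [hC, h1, h3, h4]

lemma EW_pos {n : ℕ} (c : EE n) (δ : ℝ) (k : ℕ) (τ : ℝ) (x : EE n) : 0 < EW c δ k τ x :=
  Real.exp_pos _

lemma EW_sq_le {n : ℕ} {c : EE n} {δ : ℝ} {k : ℕ} {τ : ℝ} {x : EE n} {t : ℝ} (hδ : 0 < δ)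
    (hτ : 0 ≤ τ) (ht : 0 < t) (h : t ≤ NN c x + δ) :
    EW c δ k τ x ^ 2 ≤ Real.exp (2 * τ * t⁻¹ ^ k) := by
  unfold EW
  rw [← Real.exp_nat_mul]
  apply Real.exp_le_exp.mpr
  have h1 : iot c δ x ≤ t⁻¹ := by unfold iot; gcongr
  have h0 : 0 ≤ iot c δ x := by
    unfold iot; have := NN_nonneg c x; positivity
  have h2 : iot c δ x ^ k ≤ t⁻¹ ^ k := by gcongr
  push_cast
  have h3 := mul_le_mul_of_nonneg_left h2 hτ
  linarith

lemma le_EW_sq {n : ℕ} {c : EE n} {δ : ℝ} {k : ℕ} {τ : ℝ} {x : EE n} {t : ℝ} (hδ : 0 < δ)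
    (hτ : 0 ≤ τ) (h : NN c x + δ ≤ t) :
    Real.exp (2 * τ * t⁻¹ ^ k) ≤ EW c δ k τ x ^ 2 := by
  unfold EW
  rw [← Real.exp_nat_mul]
  apply Real.exp_le_exp.mpr
  have h00 : 0 < NN c x + δ := by have := NN_nonneg c x; positivity
  have h1 : t⁻¹ ≤ iot c δ x := by unfold iot; gcongr
  have ht : 0 < t := lt_of_lt_of_le h00 h
  have h2 : t⁻¹ ^ k ≤ iot c δ x ^ k := by gcongr
  push_cast
  have h3 := mul_le_mul_of_nonneg_left h2 hτ
  linarith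

/-- the constant in the commutator bound -/
def WW (n : ℕ) (K D : ℝ) : ℝ :=
  4 * (n * (K * D)) * n + 2 * (n * (n * (K * D) + K)) + 4 * (n * (n * (K * D) * D))

lemma yy_abs_le {n : ℕ} {c x : EE n} {D : ℝ} (hD : 0 ≤ D) (h : NN c x ≤ D ^ 2) (i : Fin n) :
    |yy c i x| ≤ D := by
  apply abs_le_of_sq_le_sq _ hD
  refine le_trans ?_ h
  unfold NN
  have := Finset.single_le_sum (f := fun j => yy c j x * yy c j x)
      (fun j _ => mul_self_nonneg _) (Finset.mem_univ i)
  simpa [sq] using this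

/-- inner commutator -/
lemma cin_bound {n : ℕ} {A : Fin n → Fin n → EE n → ℝ} (hA : ∀ i j, ContDiff ℝ 1 (A i j))
    {c x : EE n} {K D S δ τ : ℝ} {k : ℕ} (hK : 0 ≤ K) (hD : 0 ≤ D)
    (ha : ∀ i j, |A i j x| ≤ K) (hda : ∀ k i j, |pd k (A i j) x| ≤ K)
    (hN : NN c x ≤ D ^ 2) (u : EE n → ℝ) (hδ : 0 < δ) (hδ1 : δ ≤ 1) (hτ : 0 ≤ τ)
    (hS : ∀ t, |deriv Real.smoothTransition t| ≤ S ∧ |deriv (deriv Real.smoothTransition) t| ≤ S) :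
    EW c δ k τ x ^ 2 * cmt A c u (deriv (stp δ δ) (NN c x)) (deriv (deriv (stp δ δ)) (NN c x)) x ^ 2
      ≤ Real.exp (2 * τ * δ⁻¹ ^ k) * (2 * (S * WW n K D) ^ 2 * δ⁻¹ ^ 4)
        * (RX (fun t => 1 - stp (2 * δ) δ t) c x * (u x ^ 2 + ∑ i, pd i u x ^ 2)) := by
  have hS0 : 0 ≤ S := (abs_nonneg _).trans (hS 0).1
  have hg : 0 ≤ u x ^ 2 + ∑ i, pd i u x ^ 2 :=
    add_nonneg (sq_nonneg _) (Finset.sum_nonneg fun i _ => sq_nonneg _)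
  have hNn := NN_nonneg c x
  by_cases h2 : NN c x ≤ 2 * δ
  · have hr : RX (fun t => 1 - stp (2 * δ) δ t) c x = 1 := by
      unfold RX; beta_reduce; rw [stp_zero hδ h2]; ring
    rw [hr, one_mul]
    obtain ⟨b1, b2⟩ := stp_deriv_bound hS (b := δ) hδ (NN c x)
    have h1 : 1 ≤ δ⁻¹ := (one_le_inv₀ hδ).mpr hδ1
    have b1' : |deriv (stp δ δ) (NN c x)| ≤ S * δ⁻¹ ^ 2 := by
      refine b1.trans ?_
      gcongr
      nlinarith
    have := cmt_bound hA hK hD ha hda (yy_abs_le hD hN) u b1' b2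
    have hE := EW_sq_le (k := k) (x := x) (c := c) hδ hτ hδ (by linarith)
    calc _ ≤ Real.exp (2 * τ * δ⁻¹ ^ k) * (2 * (S * δ⁻¹ ^ 2 * WW n K D) ^ 2
        * (u x ^ 2 + ∑ i, pd i u x ^ 2)) :=
          mul_le_mul hE this (sq_nonneg _) (Real.exp_pos _).le
      _ = _ := by ring
  · push Not at h2
    obtain ⟨e1, e2⟩ := stp_deriv_zero (b := δ) (h := δ) (t := NN c x) hδ (Or.inr (by linarith))
    rw [e1, e2, cmt_zero]
    have hr : 0 ≤ RX (fun t => 1 - stp (2 * δ) δ t) c x := by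
      unfold RX; linarith [stp_le_one (2 * δ) δ (NN c x)]
    have : 0 ≤ Real.exp (2 * τ * δ⁻¹ ^ k) := (Real.exp_pos _).le
    simp only [ne_eq, OfNat.ofNat_ne_zero, not_false_eq_true, zero_pow, mul_zero]
    positivity

lemma cout_bound {n : ℕ} {A : Fin n → Fin n → EE n → ℝ} (hA : ∀ i j, ContDiff ℝ 1 (A i j))
    {c x : EE n} {K D S δ τ a h M : ℝ} {k : ℕ} (hK : 0 ≤ K) (hD : 0 ≤ D)
    (ha : ∀ i j, |A i j x| ≤ K) (hda : ∀ k i j, |pd k (A i j) x| ≤ K)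
    (hN : NN c x ≤ D ^ 2) {u : EE n → ℝ} (hδ : 0 < δ) (hτ : 0 ≤ τ) (ha0 : 0 ≤ a) (hh : 0 < h)
    (hu : |u x| ≤ M) (hdu : ∀ i, |pd i u x| ≤ M)
    (hS : ∀ t, |deriv Real.smoothTransition t| ≤ S ∧ |deriv (deriv Real.smoothTransition) t| ≤ S) :
    EW c δ k τ x ^ 2 * cmt A c u (deriv (stp a h) (NN c x)) (deriv (deriv (stp a h)) (NN c x)) x ^ 2
      ≤ Real.exp (2 * τ * (a + δ)⁻¹ ^ k) *
        (2 * (S * (h⁻¹ + h⁻¹ ^ 2) * WW n K D) ^ 2 * (M ^ 2 + n * M ^ 2)) := by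
  have hS0 : 0 ≤ S := (abs_nonneg _).trans (hS 0).1
  have hh' : 0 < h⁻¹ := inv_pos.mpr hh
  by_cases h2 : NN c x < a
  · obtain ⟨e1, e2⟩ := stp_deriv_zero (b := a) (h := h) (t := NN c x) hh (Or.inl h2)
    rw [e1, e2, cmt_zero]
    have : 0 ≤ Real.exp (2 * τ * (a + δ)⁻¹ ^ k) := (Real.exp_pos _).le
    simp only [ne_eq, OfNat.ofNat_ne_zero, not_false_eq_true, zero_pow, mul_zero]
    positivity
  · push Not at h2
    obtain ⟨b1, b2⟩ := stp_deriv_bound hS (b := a) hh (NN c x)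
    have b1' : |deriv (stp a h) (NN c x)| ≤ S * (h⁻¹ + h⁻¹ ^ 2) := by
      refine b1.trans ?_
      gcongr
      have := sq_nonneg h⁻¹
      linarith
    have b2' : |deriv (deriv (stp a h)) (NN c x)| ≤ S * (h⁻¹ + h⁻¹ ^ 2) := by
      refine b2.trans ?_
      gcongr
      linarith
    have := cmt_bound hA hK hD ha hda (yy_abs_le hD hN) u b1' b2'
    have hE := EW_sq_le (k := k) (x := x) (c := c) (t := a + δ) hδ hτ (by positivity) (by linarith)
    refine mul_le_mul hE (this.trans ?_) (sq_nonneg _) (Real.exp_pos _).le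
    have g1 : u x ^ 2 ≤ M ^ 2 := sq_le_sq' (by linarith [(abs_le.mp hu).1]) (abs_le.mp hu).2
    have g2 : ∑ i, pd i u x ^ 2 ≤ n * M ^ 2 := by
      calc ∑ i, pd i u x ^ 2 ≤ ∑ _i : Fin n, M ^ 2 :=
            Finset.sum_le_sum fun i _ => sq_le_sq' (by linarith [(abs_le.mp (hdu i)).1]) (abs_le.mp (hdu i)).2
        _ = n * M ^ 2 := by simp
    unfold WW
    exact mul_le_mul_of_nonneg_left (add_le_add g1 g2) (by positivity)

/-- pointwise Caccioppoli inequality -/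
lemma cacc_pt {n : ℕ} {A : Fin n → Fin n → EE n → ℝ} (hA : ∀ i j, ContDiff ℝ 1 (A i j))
    {c x : EE n} {K D S δ M lam Λ ε : ℝ} (hK : 0 ≤ K) (hD : 0 ≤ D) (hlam : 0 < lam) (hΛ : 0 ≤ Λ)
    (ha : ∀ i j, |A i j x| ≤ K) (hN : NN c x ≤ D ^ 2)
    (hell : ∀ ξ : Fin n → ℝ, lam * ∑ i, ξ i ^ 2 ≤ ∑ i, (∑ j, A i j x * ξ j) * ξ i)
    {u : EE n → ℝ} (hu2 : ContDiff ℝ 2 u) (hδ : 0 < δ) (hδ1 : δ ≤ 1)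
    (hu : |u x| ≤ M) (hdu : ∀ i, |pd i u x| ≤ M) (hL : |LL A u x| ≤ Λ * |u x|)
    (hε : 0 ≤ ε) (hsm : NN c x ≤ 3 * δ → |u x| ≤ ε)
    (hS : ∀ t, |deriv Real.smoothTransition t| ≤ S ∧ |deriv (deriv Real.smoothTransition) t| ≤ S) :
    RX (fun t => 1 - stp (2 * δ) δ t) c x * (u x ^ 2 + ∑ i, pd i u x ^ 2)
      ≤ lam⁻¹ * (∑ i, pd i (fun y => RX (fun t => 1 - stp (2 * δ) δ t) c y * u y * PP A u i y) x)
        + (M + lam⁻¹ * (Λ * M + n * (n * (K * M) * (S * (2 * D))))) * (δ⁻¹ * ε) := by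
  have hS0 : 0 ≤ S := (abs_nonneg _).trans (hS 0).1
  have hM : 0 ≤ M := (abs_nonneg _).trans hu
  have h1 : 1 ≤ δ⁻¹ := (one_le_inv₀ hδ).mpr hδ1
  have hX2 : ContDiff ℝ 2 (fun t => 1 - stp (2 * δ) δ t) :=
    contDiff_const.sub (contDiff_stp2 _ _)
  have hX1 : ContDiff ℝ 1 (fun t => 1 - stp (2 * δ) δ t) := hX2.of_le (by norm_num)
  have hid := div_identity3 (z := u) (w := u) hA (contDiff_RX hX1 c) (hu2.of_le (by norm_num)) hu2 x
  have hdX : deriv (fun t => 1 - stp (2 * δ) δ t) (NN c x) = - deriv (stp (2 * δ) δ) (NN c x) := by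
    rw [deriv_const_sub]
  have hell' : lam * ∑ i, pd i u x ^ 2 ≤ ∑ i, PP A u i x * pd i u x := hell (fun i => pd i u x)
  have hz0 : 0 ≤ RX (fun t => 1 - stp (2 * δ) δ t) c x := by
    unfold RX; linarith [stp_le_one (2 * δ) δ (NN c x)]
  have hz1 : RX (fun t => 1 - stp (2 * δ) δ t) c x ≤ 1 := by
    unfold RX; linarith [stp_nonneg (2 * δ) δ (NN c x)]
  have hcase : (RX (fun t => 1 - stp (2 * δ) δ t) c x = 0 ∧
      ∀ i, pd i (RX (fun t => 1 - stp (2 * δ) δ t) c) x = 0) ∨ |u x| ≤ ε := by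
    by_cases h3 : NN c x ≤ 3 * δ
    · exact Or.inr (hsm h3)
    · push Not at h3
      left
      constructor
      · unfold RX; beta_reduce; rw [stp_one hδ (by linarith)]; ring
      · intro i
        rw [pd_RX hX1, hdX, (stp_deriv_zero hδ (Or.inr (by linarith))).1]; ring
  have hdz : ∀ i, |pd i (RX (fun t => 1 - stp (2 * δ) δ t) c) x| ≤ (S * δ⁻¹) * (2 * D) := by
    intro i
    rw [pd_RX hX1, hdX]
    refine abs_mul_le' ?_ ?_
    · rw [abs_neg]; exact (stp_deriv_bound hS hδ _).1
    · rw [abs_mul, abs_of_pos (by norm_num : (0:ℝ) < 2)]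
      have := yy_abs_le hD hN i
      linarith
  set z := RX (fun t => 1 - stp (2 * δ) δ t) c x with hz
  have hsum : |∑ i, PP A u i x * pd i (RX (fun t => 1 - stp (2 * δ) δ t) c) x|
      ≤ n * (n * (K * M) * (S * δ⁻¹ * (2 * D))) :=
    abs_sum_le' fun i => abs_mul_le' (PP_bound ha hdu i) (hdz i)
  have hA1 : |u x * ∑ i, PP A u i x * pd i (RX (fun t => 1 - stp (2 * δ) δ t) c) x|
      ≤ ε * (n * (n * (K * M) * (S * δ⁻¹ * (2 * D)))) := by
    rcases hcase with ⟨_, h0⟩ | h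
    · simp_rw [h0]; simp; positivity
    · exact abs_mul_le' h hsum
  have hA2 : z * |u x| ≤ ε := by
    rcases hcase with ⟨h0, _⟩ | h
    · rw [h0]; simpa using hε
    · calc z * |u x| ≤ 1 * ε := by gcongr
        _ = ε := one_mul _
  clear_value z
  have hA3 : z * u x ^ 2 ≤ M * ε := by
    rw [← sq_abs]
    calc z * |u x| ^ 2 = |u x| * (z * |u x|) := by ring
      _ ≤ M * ε := by gcongr
  have hA4 : |z * u x * LL A u x| ≤ Λ * M * ε := by
    rw [abs_mul, abs_mul, abs_of_nonneg hz0]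
    calc z * |u x| * |LL A u x| ≤ ε * (Λ * M) := by
          refine mul_le_mul hA2 (hL.trans ?_) (abs_nonneg _) hε
          gcongr
      _ = _ := by ring
  have hεδ : ε ≤ δ⁻¹ * ε := by nlinarith
  have h5 := mul_le_mul_of_nonneg_left hell' hz0
  have h6 : lam * (z * ∑ i, pd i u x ^ 2)
      ≤ (∑ i, pd i (fun y => RX (fun t => 1 - stp (2 * δ) δ t) c y * u y * PP A u i y) x)
        + (Λ * M + n * (n * (K * M) * (S * (2 * D)))) * (δ⁻¹ * ε) := by
    have h7 := (abs_le.mp hA1).1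
    have h8 := (abs_le.mp hA4).1
    have h9 := mul_le_mul_of_nonneg_left hεδ (mul_nonneg hΛ hM)
    rw [hid]
    linarith
  have h10 := mul_le_mul_of_nonneg_left h6 (inv_pos.mpr hlam).le
  rw [← mul_assoc, inv_mul_cancel₀ hlam.ne', one_mul] at h10
  have h11 := mul_le_mul_of_nonneg_left hεδ hM
  linarith


lemma pd_zero_of_eventually {n : ℕ} {f : EE n → ℝ} {x : EE n} (h : ∀ᶠ y in nhds x, f y = 0)
    (i : Fin n) : pd i f x = 0 := by
  rw [pd_congr i (g := fun _ => 0) h, pd_const]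

lemma FF_zero {n : ℕ} (A : Fin n → Fin n → EE n → ℝ) (c : EE n) (δ : ℝ) (k : ℕ) (τ : ℝ)
    {z : EE n → ℝ} {x : EE n} (h : ∀ᶠ y in nhds x, z y = 0) (i : Fin n) : FF A c δ k τ z i x = 0 := by
  have h1 : ∀ j, pd j z x = 0 := pd_zero_of_eventually h
  have h2 : z x = 0 := h.self_of_nhds
  have h3 : ∀ i, PP A z i x = 0 := by intro i; unfold PP; simp [h1]
  unfold FF
  simp [h1, h2, h3]

lemma pd_FF_zero {n : ℕ} (A : Fin n → Fin n → EE n → ℝ) (c : EE n) (δ : ℝ) (k : ℕ) (τ : ℝ)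
    {z : EE n → ℝ} {x : EE n} (h : ∀ᶠ y in nhds x, z y = 0) (i : Fin n) :
    pd i (FF A c δ k τ z i) x = 0 := by
  apply pd_zero_of_eventually
  filter_upwards [h.eventually_nhds] with y hy
  exact FF_zero A c δ k τ hy i

lemma NN_le_iff {n : ℕ} {c x : EE n} {R : ℝ} (hR : 0 ≤ R) : NN c x ≤ R ^ 2 ↔ x ∈ closedBall c R := by
  rw [NN_eq, mem_closedBall, dist_eq_norm]
  exact pow_le_pow_iff_left₀ (norm_nonneg _) hR (by norm_num)

lemma sq_integrable {n : ℕ} {z : EE n → ℝ} (hz : Continuous z)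
    (hzc : HasCompactSupport z) : Integrable (fun x => z x ^ 2) := by
  have h1 : HasCompactSupport (fun x => z x ^ 2) := by
    refine hzc.mono fun x hx => ?_
    rw [Function.mem_support] at hx ⊢
    intro h0
    exact hx (by rw [h0]; norm_num)
  have h2 : Continuous (fun x => z x ^ 2) := hz.pow 2
  exact h2.integrable_of_hasCompactSupport h1

lemma integrate_div {n : ℕ} {G : Fin n → EE n → ℝ} (hG : ∀ i, ContDiff ℝ 1 (G i))
    (hGc : ∀ i, HasCompactSupport (G i)) {z : EE n → ℝ} (hz : Continuous z)
    (hzc : HasCompactSupport z) {c : EE n} {R T : ℝ}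
    (h : ∀ x ∈ closedBall c R, z x ^ 2 + ∑ i, pd i (G i) x ≤ T)
    (h0 : ∀ x ∉ closedBall c R, z x ^ 2 + ∑ i, pd i (G i) x ≤ 0) :
    ∫ x, z x ^ 2 ≤ T * volume.real (closedBall c R) := by
  have hi : ∀ i, Integrable (pd i (G i)) := fun i =>
    (continuous_pd1 i (hG i)).integrable_of_hasCompactSupport (hasCompactSupport_pd i (hGc i))
  have hzi : Integrable (fun x => z x ^ 2) := by
    exact sq_integrable hz hzc
  have h1 : ∫ x, (z x ^ 2 + ∑ i, pd i (G i) x) = ∫ x, z x ^ 2 := by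
    rw [integral_add hzi (integrable_finsetSum _ fun i _ => hi i),
      integral_finsetSum _ fun i _ => hi i]
    simp [integral_pd_eq_zero _ (hG _) (hGc _)]
  rw [← h1]
  have h2 : ∫ x, (closedBall c R).indicator (fun _ => T) x = T * volume.real (closedBall c R) := by
    rw [integral_indicator measurableSet_closedBall]
    simp [mul_comm]
  rw [← h2]
  apply integral_mono (hzi.add (integrable_finsetSum _ fun i _ => hi i))
  · rw [integrable_indicator_iff measurableSet_closedBall]
    exact integrableOn_const (measure_closedBall_lt_top.ne)
  · intro x
    by_cases hx : x ∈ closedBall c R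
    · rw [indicator_of_mem hx]; exact h x hx
    · rw [indicator_of_notMem hx]; exact h0 x hx

set_option maxHeartbeats 2000000 in
theorem carleman_int (n : ℕ) {lam K D Λ M d : ℝ} (hlam : 0 < lam) (hK : 0 < K) (hD : 0 < D)
    (hΛ : 0 ≤ Λ) (hM : 0 < M) (hd : 0 < d) :
    ∃ k : ℕ, 1 ≤ k ∧ ∃ C1 : ℝ, 0 < C1 ∧ ∃ C2 : ℝ, 0 < C2 ∧ ∃ τ0 : ℝ, 0 < τ0 ∧
      ∀ (A : Fin n → Fin n → EE n → ℝ),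
      (∀ i j, ContDiff ℝ 1 (A i j)) → (∀ i j x, A i j x = A j i x) →
      ∀ (c : EE n) (u : EE n → ℝ), ContDiff ℝ 2 u → ∀ (R δ ε τ : ℝ), d ≤ R → R ≤ D →
      0 < δ → δ ≤ 1 → 3 * δ ≤ (R - d) ^ 2 → τ0 ≤ τ → 0 ≤ ε →
      (∀ x ∈ closedBall c R, ∀ i j, |A i j x| ≤ K) →
      (∀ x ∈ closedBall c R, ∀ l i j, |pd l (A i j) x| ≤ K) →
      (∀ x ∈ closedBall c R,
        ∀ ξ : Fin n → ℝ, lam * ∑ i, ξ i ^ 2 ≤ ∑ i, (∑ j, A i j x * ξ j) * ξ i) →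
      (∀ x ∈ closedBall c R, |u x| ≤ M) →
      (∀ x ∈ closedBall c R, ∀ i, |pd i u x| ≤ M) →
      (∀ x ∈ closedBall c R, |LL A u x| ≤ Λ * |u x|) →
      (∀ x, NN c x ≤ 3 * δ → |u x| ≤ ε) →
      Integrable (fun x => (EW c δ k τ x * (RX (XX δ ((R - d) ^ 2) (d ^ 2)) c x * u x)) ^ 2) ∧
      ∫ x, (EW c δ k τ x * (RX (XX δ ((R - d) ^ 2) (d ^ 2)) c x * u x)) ^ 2
        ≤ (C1 * (Real.exp (2 * τ * δ⁻¹ ^ k) * δ⁻¹ ^ 5 * ε)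
          + C2 * Real.exp (2 * τ * ((R - d) ^ 2 + δ)⁻¹ ^ k)) * volume.real (closedBall c R) := by
  obtain ⟨k, hk, τ0, hτ0, H⟩ := carleman_pt n (Λ := Λ) hlam hK hD
  obtain ⟨S, hS0, hS⟩ := st_bound
  have hh : 0 < d ^ 2 := by positivity
  set W := WW n K D with hW
  have hW0 : 0 ≤ W := by rw [hW]; unfold WW; positivity
  set Cc := M + lam⁻¹ * (Λ * M + n * (n * (K * M) * (S * (2 * D)))) with hCc
  have hCc0 : 0 ≤ Cc := by positivity
  set Cb := 2 * (S * ((d ^ 2)⁻¹ + (d ^ 2)⁻¹ ^ 2) * W) ^ 2 * (M ^ 2 + n * M ^ 2) with hCb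
  have hCb0 : 0 ≤ Cb := by positivity
  refine ⟨k, hk, 8 * (2 * (S * W) ^ 2) * Cc + 1, by positivity, 8 * Cb + 1, by positivity, τ0, hτ0, ?_⟩
  intro A hA hsym c u hu R δ ε τ hdR hRD hδ hδ1 hδR hτ hε ha hda hell hub hdu hL hsm
  have hR : 0 ≤ R := hd.le.trans hdR
  have hτp : 0 ≤ τ := hτ0.le.trans hτ
  set a := (R - d) ^ 2 with haa
  set h := d ^ 2 with hhh
  have haR : a + h ≤ R ^ 2 := by rw [haa, hhh]; nlinarith
  set X := XX δ a h with hX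
  have hX2 : ContDiff ℝ 2 X := contDiff_XX _ _ _
  set z : EE n → ℝ := fun y => EW c δ k τ y * (RX X c y * u y) with hz
  have hzC : ContDiff ℝ 2 z := (contDiff_EW c hδ k τ).mul ((contDiff_RX hX2 c).mul hu)
  have hz_zero : ∀ y, NN c y ≤ δ ∨ a + h ≤ NN c y → z y = 0 := by
    intro y hy
    have : RX X c y = 0 := XX_zero hδ hh (by linarith) hy
    simp [hz, this]
  set ζ : EE n → ℝ := RX (fun t => 1 - stp (2 * δ) δ t) c with hζ
  have hζC : ContDiff ℝ 1 ζ := by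
    apply contDiff_RX
    exact contDiff_const.sub ((contDiff_stp2 _ _).of_le (by norm_num))
  have hζ_zero : ∀ y, 3 * δ ≤ NN c y → ζ y = 0 := by
    intro y hy
    rw [hζ]; unfold RX; beta_reduce; rw [stp_one hδ (by linarith)]; ring
  set Θ := 8 * (Real.exp (2 * τ * δ⁻¹ ^ k) * (2 * (S * W) ^ 2 * δ⁻¹ ^ 4)) with hΘ
  have hΘ0 : 0 ≤ Θ := by
    have := (Real.exp_pos (2 * τ * δ⁻¹ ^ k)).le
    positivity
  set G : Fin n → EE n → ℝ := fun i y => FF A c δ k τ z i y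
    - (Θ * lam⁻¹) * (ζ y * u y * PP A u i y) with hG
  have c2 : ∀ i, ContDiff ℝ 1 (fun y => ζ y * u y * PP A u i y) := fun i =>
    (hζC.mul (hu.of_le (by norm_num))).mul (contDiff_PP hA hu i)
  have hGC : ∀ i, ContDiff ℝ 1 (G i) := fun i =>
    (contDiff_FF hA c hδ k τ hzC i).sub (contDiff_const.mul (c2 i))
  have hout : ∀ x ∉ closedBall c R, ∀ᶠ y in nhds x, a + h < NN c y ∧ y ∉ closedBall c R := by
    intro x hx
    filter_upwards [isClosed_closedBall.isOpen_compl.mem_nhds hx] with y hy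
    have : ¬ NN c y ≤ R ^ 2 := fun hh => hy ((NN_le_iff hR).mp hh)
    exact ⟨by linarith, hy⟩
  have hzev : ∀ x ∉ closedBall c R, ∀ᶠ y in nhds x, z y = 0 := by
    intro x hx
    filter_upwards [hout x hx] with y hy
    exact hz_zero y (Or.inr hy.1.le)
  have hG_zero : ∀ x ∉ closedBall c R, ∀ i, G i x = 0 := by
    intro x hx i
    have h1 := FF_zero A c δ k τ (hzev x hx) i
    have h2 := hζ_zero x (by linarith [(hout x hx).self_of_nhds.1])
    simp [hG, h1, h2]
  have hGc : ∀ i, HasCompactSupport (G i) := fun i =>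
    HasCompactSupport.intro (isCompact_closedBall c R) fun x hx => hG_zero x hx i
  have hzc : HasCompactSupport z :=
    HasCompactSupport.intro (isCompact_closedBall c R) fun x hx => (hzev x hx).self_of_nhds
  have hpdG : ∀ x, ∑ i, pd i (G i) x = ∑ i, pd i (FF A c δ k τ z i) x
      - (Θ * lam⁻¹) * ∑ i, pd i (fun y => ζ y * u y * PP A u i y) x := by
    intro x
    rw [Finset.mul_sum, ← Finset.sum_sub_distrib]
    refine Finset.sum_congr rfl fun i _ => ?_
    have d1 : DifferentiableAt ℝ (FF A c δ k τ z i) x :=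
      (contDiff_FF hA c hδ k τ hzC i).differentiable (by norm_num) x
    have d2 : DifferentiableAt ℝ (fun y => ζ y * u y * PP A u i y) x :=
      (c2 i).differentiable (by norm_num) x
    rw [hG, pd_sub i d1 (d2.const_mul _), pd_const_mul i _ d2]
  refine ⟨?_, ?_⟩
  · exact sq_integrable hzC.continuous hzc
  refine integrate_div hGC hGc hzC.continuous hzc ?_ ?_
  · intro x hx
    have hNR : NN c x ≤ R ^ 2 := (NN_le_iff hR).mpr hx
    have hND : NN c x ≤ D ^ 2 := hNR.trans (by gcongr)
    have key : z x ^ 2 + ∑ i, pd i (FF A c δ k τ z i) x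
        ≤ 4 * EW c δ k τ x ^ 2 * cmt A c u (deriv X (NN c x)) (deriv (deriv X) (NN c x)) x ^ 2 := by
      by_cases hNδ : δ ≤ NN c x
      · exact cut_pt hA hsym c hδ hk τ hX2 hu x (hL x hx)
          (H A hA hsym c δ hδ hδ1 z hzC x τ hτ (ha x hx) (hda x hx) (hell x hx) hNδ hND)
      · push Not at hNδ
        have hev : ∀ᶠ y in nhds x, z y = 0 := by
          have hc : Continuous (NN c) := (contDiff_NN c (a := 1)).continuous
          filter_upwards [hc.continuousAt.eventually_lt continuousAt_const hNδ] with y hy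
          exact hz_zero y (Or.inl hy.le)
        rw [hev.self_of_nhds]
        simp_rw [pd_FF_zero A c δ k τ hev]
        simp; positivity
    have hin := cin_bound (k := k) hA hK.le hD.le (ha x hx) (hda x hx) hND u hδ hδ1 hτp hS
    have hou := cout_bound (k := k) (a := a) (h := h) hA hK.le hD.le (ha x hx) (hda x hx) hND hδ hτp
      (by positivity) hh (hub x hx) (hdu x hx) hS
    have hca := cacc_pt hA hK.le hD.le hlam hΛ (ha x hx) hND (hell x hx) hu hδ hδ1 (hub x hx)
      (hdu x hx) (hL x hx) hε (hsm x) hS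
    rw [hX, deriv2_XX, deriv_XX, cmt_sub] at key
    rw [← hW, ← hζ] at hin
    rw [← hW, ← hCb] at hou
    rw [← hCc, ← hζ] at hca
    rw [hpdG]
    have h5 := mul_le_mul_of_nonneg_left hca hΘ0
    generalize cmt A c u (deriv (stp δ δ) (NN c x)) (deriv (deriv (stp δ δ)) (NN c x)) x = p at *
    generalize cmt A c u (deriv (stp a h) (NN c x)) (deriv (deriv (stp a h)) (NN c x)) x = q at *
    have h6 : (p - q) ^ 2 ≤ 2 * p ^ 2 + 2 * q ^ 2 := by linarith only [sq_nonneg (p + q)]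
    have h7 := mul_le_mul_of_nonneg_left h6 (sq_nonneg (EW c δ k τ x))
    have h8 : Θ * (Cc * (δ⁻¹ * ε)) = 8 * (2 * (S * W) ^ 2) * Cc
        * (Real.exp (2 * τ * δ⁻¹ ^ k) * δ⁻¹ ^ 5 * ε) := by rw [hΘ]; ring
    have h9 : 0 ≤ Real.exp (2 * τ * δ⁻¹ ^ k) * δ⁻¹ ^ 5 * ε := by
      have := (Real.exp_pos (2 * τ * δ⁻¹ ^ k)).le
      positivity
    have h10 := (Real.exp_pos (2 * τ * (a + δ)⁻¹ ^ k)).le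
    have h11 : 8 * (Real.exp (2 * τ * δ⁻¹ ^ k) * (2 * (S * W) ^ 2 * δ⁻¹ ^ 4)
        * (ζ x * (u x ^ 2 + ∑ i, pd i u x ^ 2))) = Θ * (ζ x * (u x ^ 2 + ∑ i, pd i u x ^ 2)) := by
      rw [hΘ]; ring
    clear_value Θ
    linarith only [key, h7, hin, hou, h5, h8, h9, h10, h11]
  · intro x hx
    have h1 : ∑ i, pd i (G i) x = 0 := by
      refine Finset.sum_eq_zero fun i _ => pd_zero_of_eventually ?_ i
      filter_upwards [hout x hx] with y hy
      exact hG_zero y hy.2 i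
    rw [h1, (hzev x hx).self_of_nhds]; simp


lemma exists_exp_small {P Q : ℝ} (hP : 0 < P) (hQ : 0 < Q) : ∃ B : ℝ, 0 ≤ B ∧ P * Real.exp (-B) ≤ Q := by
  refine ⟨P / Q, by positivity, ?_⟩
  have h1 := Real.add_one_le_exp (P / Q)
  rw [Real.exp_neg, ← div_eq_mul_inv, div_le_iff₀ (Real.exp_pos _)]
  have h2 : P = Q * (P / Q) := by field_simp
  have h3 : Q * (P / Q) ≤ Q * Real.exp (P / Q) := mul_le_mul_of_nonneg_left (by linarith) hQ.le
  linarith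

lemma phi_gap {k : ℕ} (hk : 1 ≤ k) {t1 t2 B h : ℝ} (h1 : 0 < t1) (hh : 0 < h) (h2 : t1 + h ≤ t2) (h3 : t2 ≤ B) :
    h * B⁻¹ ^ (k + 1) ≤ t1⁻¹ ^ k - t2⁻¹ ^ k := by
  obtain ⟨l, rfl⟩ : ∃ l, k = l + 1 := ⟨k - 1, by omega⟩
  have ht2 : 0 < t2 := by linarith
  have hB : 0 < B := by linarith
  have a1 : t2⁻¹ ≤ t1⁻¹ := by gcongr; linarith
  have a2 : B⁻¹ ≤ t2⁻¹ := by gcongr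
  have a3 : h * (B⁻¹ * B⁻¹) ≤ t1⁻¹ - t2⁻¹ := by
    have : t1⁻¹ - t2⁻¹ = (t2 - t1) * (t1⁻¹ * t2⁻¹) := by field_simp
    rw [this]
    have a4 : B⁻¹ ≤ t1⁻¹ := a2.trans a1
    have hB' : 0 < B⁻¹ := inv_pos.mpr hB
    have : 0 < t1⁻¹ := inv_pos.mpr h1
    exact mul_le_mul (by linarith) (mul_le_mul a4 a2 hB'.le this.le) (by positivity) (by linarith)
  have hB' : 0 < B⁻¹ := inv_pos.mpr hB
  have ht2' : 0 < t2⁻¹ := inv_pos.mpr ht2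
  have ht1' : 0 < t1⁻¹ := inv_pos.mpr h1
  have a5 : t1⁻¹ * t2⁻¹ ^ l ≤ t1⁻¹ ^ (l + 1) := by
    rw [pow_succ, mul_comm]; gcongr
  have a6 : h * (B⁻¹ * B⁻¹) * B⁻¹ ^ l ≤ (t1⁻¹ - t2⁻¹) * t2⁻¹ ^ l := by
    apply mul_le_mul a3 (by gcongr) (by positivity) (by linarith)
  have a7 : h * B⁻¹ ^ (l + 1 + 1) = h * (B⁻¹ * B⁻¹) * B⁻¹ ^ l := by ring
  have a8 : t2⁻¹ ^ (l + 1) = t2⁻¹ * t2⁻¹ ^ l := by ring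
  rw [a7, a8]
  linarith

set_option maxHeartbeats 1000000 in
theorem core_lemma (n : ℕ) {lam K D Λ M d η ρ : ℝ} (hlam : 0 < lam) (hK : 0 < K) (hD : 0 < D)
    (hΛ : 0 ≤ Λ) (hM : 0 < M) (hd : 0 < d) (hη : 0 < η) (hρ : 0 < ρ) :
    ∃ k : ℕ, 1 ≤ k ∧ ∃ C : ℝ, 0 < C ∧ ∃ δ0 : ℝ, 0 < δ0 ∧ δ0 ≤ 1 ∧
      ∀ (A : Fin n → Fin n → EE n → ℝ),
      (∀ i j, ContDiff ℝ 1 (A i j)) → (∀ i j x, A i j x = A j i x) →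
      ∀ (c : EE n) (u : EE n → ℝ), ContDiff ℝ 2 u → ∀ (R δ : ℝ), 2 * d ≤ R → R ≤ D →
      0 < δ → δ ≤ δ0 →
      (∀ x ∈ closedBall c R, ∀ i j, |A i j x| ≤ K) →
      (∀ x ∈ closedBall c R, ∀ l i j, |pd l (A i j) x| ≤ K) →
      (∀ x ∈ closedBall c R,
        ∀ ξ : Fin n → ℝ, lam * ∑ i, ξ i ^ 2 ≤ ∑ i, (∑ j, A i j x * ξ j) * ξ i) →
      (∀ x ∈ closedBall c R, |u x| ≤ M) →
      (∀ x ∈ closedBall c R, ∀ i, |pd i u x| ≤ M) →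
      (∀ x ∈ closedBall c R, |LL A u x| ≤ Λ * |u x|) →
      ∀ y0 : EE n, (∀ y ∈ ball y0 ρ, ρ ≤ ‖y - c‖ ∧ ‖y - c‖ ≤ R - 2 * d ∧ η ≤ |u y|) →
      ∃ y, NN c y ≤ 3 * δ ∧ Real.exp (-(C * δ⁻¹ ^ k)) ≤ |u y| := by
  obtain ⟨k, hk, C1, hC1, C2, hC2, τ0, hτ0, H⟩ := carleman_int n hlam hK hD hΛ hM hd
  set V0 := volume.real (ball (0 : EE n) ρ) with hV0
  have hV0p : 0 < V0 := by
    rw [hV0, measureReal_def]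
    exact ENNReal.toReal_pos (measure_ball_pos _ _ hρ).ne' measure_ball_lt_top.ne
  set VD := volume.real (closedBall (0 : EE n) D) with hVD
  have hVDp : 0 < VD := by
    rw [hVD, measureReal_def]
    exact ENNReal.toReal_pos (measure_closedBall_pos _ _ hD).ne' measure_closedBall_lt_top.ne
  set B : ℝ := D ^ 2 + 1 with hB
  have hBp : 0 < B := by positivity
  set Δ := d ^ 2 * B⁻¹ ^ (k + 1) with hΔ
  have hΔp : 0 < Δ := by positivity
  obtain ⟨b1, hb1, hb1'⟩ := exists_exp_small (P := C2 * VD) (Q := η ^ 2 * V0 / 4) (by positivity) (by positivity)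
  obtain ⟨b2, hb2, hb2'⟩ := exists_exp_small (P := C1 * VD) (Q := η ^ 2 * V0 / 2) (by positivity) (by positivity)
  set τ := max τ0 (b1 / (2 * Δ)) with hτ
  have hττ : τ0 ≤ τ := le_max_left _ _
  have hτp : 0 < τ := lt_of_lt_of_le hτ0 hττ
  have hτb : b1 ≤ 2 * τ * Δ := by
    have := le_max_right τ0 (b1 / (2 * Δ))
    rw [← hτ, div_le_iff₀ (by positivity)] at this
    linarith
  clear_value τ Δ
  refine ⟨k, hk, 2 * τ + 5 + b2, by positivity, min 1 (min (ρ ^ 2 / 2) (d ^ 2 / 3)), by positivity,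
    min_le_left _ _, ?_⟩
  intro A hA hsym c u hu R δ hdR hRD hδ hδ0 ha hda hell hub hdu hL y0 hy0
  have hδ1 : δ ≤ 1 := hδ0.trans (min_le_left _ _)
  have hδρ : 2 * δ ≤ ρ ^ 2 := by
    have := hδ0.trans ((min_le_right _ _).trans (min_le_left _ _)); linarith
  have hδd : 3 * δ ≤ d ^ 2 := by
    have := hδ0.trans ((min_le_right _ _).trans (min_le_right _ _)); linarith
  by_contra hcon
  push Not at hcon
  set ε := Real.exp (-((2 * τ + 5 + b2) * δ⁻¹ ^ k)) with hε
  have hRd : d ^ 2 ≤ (R - d) ^ 2 := by apply pow_le_pow_left₀ hd.le; linarith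
  obtain ⟨hintg, hI⟩ := H A hA hsym c u hu R δ ε τ (by linarith) hRD hδ hδ1 (hδd.trans hRd) hττ
    (Real.exp_pos _).le ha hda hell hub hdu hL (fun x hx => (hcon x hx).le)
  have hvol : volume.real (closedBall c R) ≤ VD := by
    have : volume.real (closedBall c D) = VD := by
      rw [hVD, measureReal_def, measureReal_def, Measure.addHaar_closedBall_center]
    rw [← this]
    exact measureReal_mono (closedBall_subset_closedBall hRD) measure_closedBall_lt_top.ne
  -- lower bound
  set t1 := (R - 2 * d) ^ 2 + δ with ht1
  set t2 := (R - d) ^ 2 + δ with ht2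
  have hlow : η ^ 2 * Real.exp (2 * τ * t1⁻¹ ^ k) * V0
      ≤ ∫ x, (EW c δ k τ x * (RX (XX δ ((R - d) ^ 2) (d ^ 2)) c x * u x)) ^ 2 := by
    have e1 : V0 = volume.real (ball y0 ρ) := by
      rw [hV0, measureReal_def, measureReal_def, Measure.addHaar_ball_center volume y0]
    calc η ^ 2 * Real.exp (2 * τ * t1⁻¹ ^ k) * V0
        = ∫ x in ball y0 ρ, η ^ 2 * Real.exp (2 * τ * t1⁻¹ ^ k) := by
          rw [setIntegral_const, smul_eq_mul, e1]; ring
      _ ≤ ∫ x in ball y0 ρ, (EW c δ k τ x * (RX (XX δ ((R - d) ^ 2) (d ^ 2)) c x * u x)) ^ 2 := by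
          refine setIntegral_mono_on (integrableOn_const measure_ball_lt_top.ne) hintg.integrableOn
            measurableSet_ball fun y hy => ?_
          obtain ⟨g1, g2, g3⟩ := hy0 y hy
          have n1 : ρ ^ 2 ≤ NN c y := by rw [NN_eq]; gcongr
          have n2 : NN c y ≤ (R - 2 * d) ^ 2 := by rw [NN_eq]; gcongr
          have n3 : (R - 2 * d) ^ 2 ≤ (R - d) ^ 2 := by
            apply pow_le_pow_left₀ (by linarith); linarith
          have n4 : RX (XX δ ((R - d) ^ 2) (d ^ 2)) c y = 1 :=
            XX_one hδ (by positivity) (by linarith) (by linarith)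
          rw [n4, one_mul, mul_pow, mul_comm]
          have n5 := le_EW_sq (k := k) (c := c) (x := y) (t := t1) hδ hτp.le (by rw [ht1]; linarith)
          have n6 : η ^ 2 ≤ u y ^ 2 := by rw [← sq_abs (u y)]; gcongr
          exact mul_le_mul n5 n6 (by positivity) (by positivity)
      _ ≤ _ := setIntegral_le_integral hintg (Filter.Eventually.of_forall fun x => sq_nonneg _)
  have hgap : Δ ≤ t1⁻¹ ^ k - t2⁻¹ ^ k := by
    rw [hΔ]
    refine phi_gap hk (by positivity) (by positivity) ?_ ?_
    · rw [ht1, ht2]; nlinarith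
    · rw [ht2, hB]
      have : (R - d) ^ 2 ≤ D ^ 2 := by apply pow_le_pow_left₀ <;> linarith
      linarith
  set E1 := Real.exp (2 * τ * t1⁻¹ ^ k) with hE1
  have hE1' : 1 ≤ E1 := by
    apply Real.one_le_exp; positivity
  have hE2 : C2 * Real.exp (2 * τ * t2⁻¹ ^ k) * VD ≤ η ^ 2 * V0 / 4 * E1 := by
    have : Real.exp (2 * τ * t2⁻¹ ^ k) ≤ Real.exp (-b1) * E1 := by
      rw [hE1, ← Real.exp_add]
      apply Real.exp_le_exp.mpr
      have := mul_le_mul_of_nonneg_left hgap (by positivity : 0 ≤ 2 * τ)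
      linarith
    calc C2 * Real.exp (2 * τ * t2⁻¹ ^ k) * VD ≤ C2 * (Real.exp (-b1) * E1) * VD := by gcongr
      _ = (C2 * VD * Real.exp (-b1)) * E1 := by ring
      _ ≤ _ := by gcongr
  have hδk : δ⁻¹ ≤ δ⁻¹ ^ k := le_self_pow₀ ((one_le_inv₀ hδ).mpr hδ1) (by omega)
  have hδk1 : 1 ≤ δ⁻¹ ^ k := ((one_le_inv₀ hδ).mpr hδ1).trans hδk
  have hE3 : C1 * (Real.exp (2 * τ * δ⁻¹ ^ k) * δ⁻¹ ^ 5 * ε) * VD ≤ η ^ 2 * V0 / 2 := by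
    have q1 : δ⁻¹ ^ 5 ≤ Real.exp (5 * δ⁻¹ ^ k) := by
      have : δ⁻¹ ≤ Real.exp (δ⁻¹ ^ k) := by
        linarith [Real.add_one_le_exp (δ⁻¹ ^ k)]
      calc δ⁻¹ ^ 5 ≤ Real.exp (δ⁻¹ ^ k) ^ 5 := by gcongr
        _ = _ := by rw [← Real.exp_nat_mul]; norm_num
    have q2 : Real.exp (2 * τ * δ⁻¹ ^ k) * δ⁻¹ ^ 5 * ε ≤ Real.exp (-b2) := by
      calc Real.exp (2 * τ * δ⁻¹ ^ k) * δ⁻¹ ^ 5 * ε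
          ≤ Real.exp (2 * τ * δ⁻¹ ^ k) * Real.exp (5 * δ⁻¹ ^ k) * ε := by gcongr
        _ = Real.exp (-(b2 * δ⁻¹ ^ k)) := by
          rw [hε, ← Real.exp_add, ← Real.exp_add]; congr 1; ring
        _ ≤ _ := by
          apply Real.exp_le_exp.mpr
          have := mul_le_mul_of_nonneg_left hδk1 hb2
          linarith
    calc _ ≤ C1 * Real.exp (-b2) * VD := by gcongr
      _ = C1 * VD * Real.exp (-b2) := by ring
      _ ≤ _ := hb2'
  have hbig := hlow.trans hI
  have hε0 : 0 < ε := Real.exp_pos _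
  have h12 : (C1 * (Real.exp (2 * τ * δ⁻¹ ^ k) * δ⁻¹ ^ 5 * ε)
          + C2 * Real.exp (2 * τ * t2⁻¹ ^ k)) * volume.real (closedBall c R)
      ≤ (C1 * (Real.exp (2 * τ * δ⁻¹ ^ k) * δ⁻¹ ^ 5 * ε)
          + C2 * Real.exp (2 * τ * t2⁻¹ ^ k)) * VD := by
    gcongr
  have h13 : η ^ 2 * V0 * 1 ≤ η ^ 2 * V0 * E1 := by gcongr
  have h14 : 0 < η ^ 2 * V0 := by positivity
  linarith


lemma final_asym {C M δ0 α : ℝ} {k : ℕ} (hk : 1 ≤ k) (hC : 0 < C) (hM : 0 < M) (hδ0 : 0 < δ0)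
    (hα : 0 < α) :
    ∃ C₀ > 0, ∀ s : ℝ, 0 < s → s < 1 → ∀ F : ℝ, F ≤ M →
      (∀ δ, 0 < δ → δ ≤ δ0 → F ≤ s * Real.exp (2 * (C * δ⁻¹ ^ k)) + M * (2 * Real.sqrt δ) ^ α) →
      F ≤ C₀ * ((|Real.log (1 * |Real.log s|)| ^ (1 / α))⁻¹ + s) := by
  have hk0 : (0:ℝ) < k := by exact_mod_cast hk
  set β : ℝ := 1 / (k:ℝ) * (1 / 2) * α with hβ
  have hβp : 0 < β := by positivity
  set c : ℝ := M * (2 ^ α * (4 * C) ^ β) with hc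
  have t1 : Filter.Tendsto (fun L : ℝ => Real.log L ^ (1 / α) / L ^ (1:ℝ)) Filter.atTop (nhds 0) :=
    (isLittleO_log_rpow_rpow_atTop (1 / α) one_pos).tendsto_div_nhds_zero
  have t2 : Filter.Tendsto (fun L : ℝ => Real.log L ^ (1 / α) / L ^ β) Filter.atTop (nhds 0) :=
    (isLittleO_log_rpow_rpow_atTop (1 / α) hβp).tendsto_div_nhds_zero
  have t3 : Filter.Tendsto (fun L : ℝ => 2 * (Real.log L ^ (1 / α) / L ^ (1:ℝ))
      + c * (Real.log L ^ (1 / α) / L ^ β)) Filter.atTop (nhds 0) := by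
    have := (t1.const_mul 2).add (t2.const_mul c)
    simpa using this
  have e1 := t3.eventually (gt_mem_nhds (one_pos))
  obtain ⟨L0, hL0⟩ := Filter.eventually_atTop.mp
    ((e1.and (Filter.eventually_ge_atTop (Real.exp 1))).and
      (Filter.eventually_ge_atTop (4 * C * δ0⁻¹ ^ k)))
  refine ⟨max 1 (M * Real.exp L0), lt_of_lt_of_le one_pos (le_max_left _ _), ?_⟩
  intro s hs hs1 F hFM hF
  have hlog : Real.log s < 0 := Real.log_neg hs hs1
  rw [one_mul, abs_of_neg hlog]
  set L := - Real.log s with hL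
  have hLp : 0 < L := by rw [hL]; linarith
  have hsL : s = Real.exp (-L) := by rw [hL, neg_neg, Real.exp_log hs]
  have hinv : 0 ≤ (|Real.log L| ^ (1 / α))⁻¹ := by positivity
  rcases lt_or_ge L L0 with h | h
  · have : M ≤ M * Real.exp L0 * s := by
      rw [hsL, mul_assoc, ← Real.exp_add]
      have : 1 ≤ Real.exp (L0 + -L) := Real.one_le_exp (by linarith)
      nlinarith
    calc F ≤ M := hFM
      _ ≤ M * Real.exp L0 * s := this
      _ ≤ max 1 (M * Real.exp L0) * s := by gcongr; exact le_max_right _ _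
      _ ≤ _ := by gcongr; linarith
  · obtain ⟨⟨g1, g2⟩, g3⟩ := hL0 L h
    have hlogL : 1 ≤ Real.log L := by
      rw [Real.le_log_iff_exp_le hLp]; exact g2
    have hx : 0 < 4 * C / L := by positivity
    set δ : ℝ := (4 * C / L) ^ (1 / (k:ℝ)) with hδ
    have hδp : 0 < δ := by positivity
    have hδk : δ ^ k = 4 * C / L := by
      rw [hδ, ← Real.rpow_natCast, ← Real.rpow_mul hx.le]
      rw [one_div_mul_cancel hk0.ne', Real.rpow_one]
    have hδle : δ ≤ δ0 := by
      by_contra hlt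
      push Not at hlt
      have h1 : δ0 ^ k < δ ^ k := pow_lt_pow_left₀ hlt hδ0.le (by omega)
      rw [hδk, lt_div_iff₀ hLp] at h1
      rw [inv_pow, ← div_eq_mul_inv, div_le_iff₀ (by positivity)] at g3
      linarith
    have hF1 := hF δ hδp hδle
    have h2 : s * Real.exp (2 * (C * δ⁻¹ ^ k)) ≤ 2 / L := by
      rw [inv_pow, hδk, hsL, ← Real.exp_add]
      have : -L + 2 * (C * (4 * C / L)⁻¹) = -(L / 2) := by field_simp; ring
      rw [this, Real.exp_neg]
      have h3 := Real.add_one_le_exp (L / 2)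
      have h4 : (2 / L) = (L / 2)⁻¹ := by field_simp
      rw [h4]
      gcongr
      linarith
    have h5 : (2 * Real.sqrt δ) ^ α = 2 ^ α * (4 * C) ^ β / L ^ β := by
      rw [Real.mul_rpow (by norm_num) (Real.sqrt_nonneg _), Real.sqrt_eq_rpow, hδ,
        ← Real.rpow_mul hx.le, ← Real.rpow_mul hx.le, ← hβ, Real.div_rpow (by positivity) hLp.le]
      ring
    have h6 : F ≤ (Real.log L ^ (1 / α))⁻¹ := by
      have hp : 0 < Real.log L ^ (1 / α) := by apply Real.rpow_pos_of_pos; linarith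
      have h7 : F ≤ 2 / L + c / L ^ β := by
        rw [h5] at hF1
        have : M * (2 ^ α * (4 * C) ^ β / L ^ β) = c / L ^ β := by rw [hc]; ring
        linarith
      rw [Real.rpow_one] at g1
      have h8 : (2 / L + c / L ^ β) * Real.log L ^ (1 / α) ≤ 1 := by
        refine le_trans (le_of_eq ?_) g1.le
        ring
      rw [← one_div, le_div_iff₀ hp]
      exact le_trans (mul_le_mul_of_nonneg_right h7 hp.le) h8
    rw [abs_of_pos (by linarith : 0 < Real.log L)] at hinv ⊢
    calc F ≤ 1 * (Real.log L ^ (1 / α))⁻¹ := by linarith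
      _ ≤ max 1 (M * Real.exp L0) * ((Real.log L ^ (1 / α))⁻¹) := by
          gcongr; exact le_max_left _ _
      _ ≤ _ := by gcongr; linarith

lemma cutoff_exists {n : ℕ} {Ω : Set (EE n)} (hΩo : IsOpen Ω) {d : ℝ} (hd : 0 < d) :
    ∃ χ : EE n → ℝ, ContDiff ℝ 2 χ ∧ (∀ x ∉ Ω, χ =ᶠ[nhds x] fun _ => 0) ∧
      ∀ x ∈ Ω, d ≤ infDist x (frontier Ω) → χ =ᶠ[nhds x] fun _ => 1 := by
  set T : Set (EE n) := closure Ω ∩ {x | d ≤ infDist x (frontier Ω)} with hT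
  have hTc : IsClosed T := isClosed_closure.inter
    (isClosed_le continuous_const (continuous_infDist_pt _))
  have hdis : Disjoint Ωᶜ T := by
    rw [Set.disjoint_left]
    rintro x hx ⟨h1, h2⟩
    have : x ∈ frontier Ω := by rw [hΩo.frontier_eq]; exact ⟨h1, hx⟩
    have h3 := infDist_zero_of_mem this
    simp only [mem_ofPred_eq] at h2
    linarith
  obtain ⟨f, h0, h1, -⟩ := exists_contMDiffMap_zero_one_nhds_of_isClosed
    (n := 2) (modelWithCornersSelf ℝ (EE n)) hΩo.isClosed_compl hTc hdis
  refine ⟨f, f.contMDiff.contDiff, ?_, ?_⟩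
  · intro x hx
    exact h0.filter_mono (nhds_le_nhdsSet hx)
  · intro x hx hxd
    have hxT : x ∈ T := ⟨subset_closure hx, hxd⟩
    exact h1.filter_mono (nhds_le_nhdsSet hxT)

lemma cutoff_mul {n : ℕ} {Ω : Set (EE n)} (hΩo : IsOpen Ω) {χ g : EE n → ℝ} {k : ℕ} (hk : k ≤ 2)
    (hχ : ContDiff ℝ 2 χ) (h0 : ∀ x ∉ Ω, χ =ᶠ[nhds x] fun _ => 0)
    (hg : ContDiffOn ℝ k g Ω) : ContDiff ℝ k (fun x => χ x * g x) := by
  rw [contDiff_iff_contDiffAt]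
  intro x
  by_cases hx : x ∈ Ω
  · exact (hχ.contDiffAt.of_le (by exact_mod_cast hk)).mul (hg.contDiffAt (hΩo.mem_nhds hx))
  · have : (fun x => χ x * g x) =ᶠ[nhds x] fun _ => 0 := by
      filter_upwards [h0 x hx] with y hy
      rw [hy, zero_mul]
    exact contDiffAt_const.congr_of_eventuallyEq this

lemma continuous_LL {n : ℕ} {A : Fin n → Fin n → EE n → ℝ} {u : EE n → ℝ}
    (hA : ∀ i j, ContDiff ℝ 1 (A i j)) (hu : ContDiff ℝ 2 u) : Continuous (LL A u) := by
  unfold LL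
  refine continuous_finsetSum _ fun i _ => continuous_pd1 i ?_
  unfold PP
  exact ContDiff.sum fun j _ => (hA i j).mul (contDiff_pd2 j hu)

lemma ae_to_all {n : ℕ} {U : Set (EE n)} (hU : IsOpen U) {g : EE n → ℝ} (hg : Continuous g)
    (h : ∀ᵐ x ∂(volume.restrict U), g x ≤ 0) : ∀ x ∈ U, g x ≤ 0 := by
  intro x hx
  by_contra hlt
  push Not at hlt
  have ho : IsOpen (U ∩ {x | 0 < g x}) := hU.inter (isOpen_lt continuous_const hg)
  have hpos := ho.measure_pos volume ⟨x, hx, hlt⟩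
  rw [ae_restrict_iff' hU.measurableSet] at h
  have : volume (U ∩ {x | 0 < g x}) = 0 := by
    refine measure_mono_null ?_ (ae_iff.mp h)
    rintro y ⟨h1, h2⟩
    simp only [mem_ofPred_eq] at h2 ⊢
    push Not
    exact ⟨h1, h2⟩
  exact hpos.ne' this

lemma ball_sub_Omega {n : ℕ} {Ω : Set (EE n)} (hΩo : IsOpen Ω) {x : EE n} (hx : x ∈ Ω) :
    ball x (infDist x (frontier Ω)) ⊆ Ω := by
  rcases (ball x (infDist x (frontier Ω))).eq_empty_or_nonempty with h | h
  · rw [h]; exact empty_subset _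
  have hpre : IsPreconnected (ball x (infDist x (frontier Ω))) := (convex_ball _ _).isPreconnected
  have hr : 0 < infDist x (frontier Ω) := by
    by_contra hle; rw [ball_eq_empty.mpr (by linarith)] at h; exact not_nonempty_empty h
  refine hpre.subset_left_of_subset_union hΩo isClosed_closure.isOpen_compl
    (Set.disjoint_left.mpr fun y h1 h2 => h2 (subset_closure h1)) ?_ ⟨x, mem_ball_self hr, hx⟩
  intro y hy
  by_cases h1 : y ∈ Ω
  · exact Or.inl h1
  · right
    intro h2
    have h3 : y ∈ frontier Ω := by rw [hΩo.frontier_eq]; exact ⟨h2, h1⟩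
    have := infDist_le_dist_of_mem (x := x) h3
    rw [mem_ball, dist_comm] at hy
    linarith

lemma frontier_ne {n : ℕ} (hn : n ≠ 0) {Ω : Set (EE n)} (hΩb : Bornology.IsBounded Ω)
    (hne : Ω.Nonempty) : (frontier Ω).Nonempty := by
  haveI : NeZero n := ⟨hn⟩
  by_contra h
  rw [not_nonempty_iff_eq_empty, frontier_eq_empty_iff] at h
  rcases h with h | h
  · exact hne.ne_empty h
  · rw [h] at hΩb
    exact NormedSpace.unbounded_univ ℝ (EE n) hΩb


lemma LL_congr {n : ℕ} {A A' : Fin n → Fin n → EE n → ℝ} {u u' : EE n → ℝ} {x : EE n}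
    (hA : ∀ i j, A i j =ᶠ[nhds x] A' i j) (hu : u =ᶠ[nhds x] u') :
    ∑ i, ∑ j, pd i (fun y => A i j y * pd j u y) x
      = ∑ i, ∑ j, pd i (fun y => A' i j y * pd j u' y) x := by
  refine Finset.sum_congr rfl fun i _ => Finset.sum_congr rfl fun j _ => pd_congr i ?_
  filter_upwards [hA i j, hu.eventuallyEq_nhds] with y h1 h2
  rw [h1, pd_congr j h2]

lemma abs_pd_le {n : ℕ} (i : Fin n) (u : EE n → ℝ) (x : EE n) : |pd i u x| ≤ ‖fderiv ℝ u x‖ := by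
  unfold pd
  have := (fderiv ℝ u x).le_opNorm (EuclideanSpace.single i 1)
  simpa using this

lemma exists_common_bound {n : ℕ} {S : Set (EE n)} (hS : IsCompact S)
    {A : Fin n → Fin n → EE n → ℝ} (hA : ∀ i j, ContDiff ℝ 1 (A i j)) :
    ∃ K : ℝ, 0 < K ∧ (∀ x ∈ S, ∀ i j, |A i j x| ≤ K) ∧
      (∀ x ∈ S, ∀ l i j, |pd l (A i j) x| ≤ K) := by
  have c1 : Continuous fun x => ∑ i, ∑ j, (|A i j x| + ∑ l, |pd l (A i j) x|) := by
    refine continuous_finsetSum _ fun i _ => continuous_finsetSum _ fun j _ => ?_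
    exact (hA i j).continuous.abs.add
      (continuous_finsetSum _ fun l _ => (continuous_pd1 l (hA i j)).abs)
  obtain ⟨K, hK⟩ := hS.exists_bound_of_continuousOn c1.continuousOn
  have key : ∀ x ∈ S, ∀ i j, |A i j x| + ∑ l, |pd l (A i j) x| ≤ K := by
    intro x hx i j
    refine le_trans ?_ ((le_abs_self _).trans (hK x hx))
    have p : ∀ i j, 0 ≤ |A i j x| + ∑ l, |pd l (A i j) x| := fun i j => by positivity
    refine le_trans (Finset.single_le_sum (f := fun j => |A i j x| + ∑ l, |pd l (A i j) x|)
      (fun j _ => p i j) (Finset.mem_univ j)) ?_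
    exact Finset.single_le_sum (f := fun i => ∑ j, (|A i j x| + ∑ l, |pd l (A i j) x|))
      (fun i _ => Finset.sum_nonneg fun j _ => p i j) (Finset.mem_univ i)
  refine ⟨max K 1, lt_of_lt_of_le one_pos (le_max_right _ _), ?_, ?_⟩
  · intro x hx i j
    have h1 := key x hx i j
    have h2 : 0 ≤ ∑ l, |pd l (A i j) x| := by positivity
    exact le_trans (by linarith) (le_max_left _ _)
  · intro x hx l i j
    have h1 := key x hx i j
    have h2 : |pd l (A i j) x| ≤ ∑ l, |pd l (A i j) x| :=
      Finset.single_le_sum (f := fun l => |pd l (A i j) x|) (fun l _ => abs_nonneg _)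
        (Finset.mem_univ l)
    have h3 := abs_nonneg (A i j x)
    exact le_trans (by linarith) (le_max_left _ _)

set_option maxHeartbeats 1000000 in
lemma main_local {n : ℕ} (hn : n ≠ 0)
    (Ω : Set (EE n))
    (hΩo : IsOpen Ω) (hΩb : Bornology.IsBounded Ω) (hne : Ω.Nonempty)
    (A : Fin n → Fin n → EE n → ℝ) (hA : EllipticSym Ω A)
    (Λ M η d₀ : ℝ) (hΛ : 0 < Λ) (hM : 0 < M) (hη : 0 < η) (hd₀ : 0 < d₀) :
    ∃ k : ℕ, 1 ≤ k ∧ ∃ C : ℝ, 0 < C ∧ ∃ δ0 : ℝ, 0 < δ0 ∧ 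
    ∀ q u : EE n → ℝ, (∀ᵐ x ∂(volume.restrict Ω), |q x| ≤ Λ) →
      ContDiffOn ℝ 2 u Ω → C1BoundOn Ω u M → IsSolution A q u Ω →
      (∀ x ∈ closure Ω, infDist x (frontier Ω) ≤ d₀ → η ≤ |u x|) →
      ∀ x ∈ Ω, ∀ δ, 0 < δ → δ ≤ δ0 →
        ∃ y ∈ Ω, ‖y - x‖ ≤ 2 * Real.sqrt δ ∧ Real.exp (-(C * δ⁻¹ ^ k)) ≤ |u y| := by
  obtain ⟨hsym, hAc, lam, hlam, hell⟩ := hA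
  have hFne := frontier_ne hn hΩb hne
  obtain ⟨χ, hχ, hχ0, hχ1⟩ := cutoff_exists hΩo (d := d₀ / 4) (by linarith)
  set A' : Fin n → Fin n → EE n → ℝ := fun i j x => χ x * A i j x with hA'
  have hA'c : ∀ i j, ContDiff ℝ 1 (A' i j) := fun i j => by
    have := cutoff_mul hΩo (k := 1) (by norm_num) hχ hχ0
      (g := A i j) (by exact_mod_cast (hAc i j).mono subset_closure)
    exact_mod_cast this
  have hA's : ∀ i j x, A' i j x = A' j i x := by
    intro i j x
    by_cases hx : x ∈ Ω
    · simp only [hA']; rw [hsym i j x (subset_closure hx)]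
    · have := (hχ0 x hx).eq_of_nhds
      simp only [hA', this, zero_mul]
  have hcomp : IsCompact (closure Ω) := hΩb.isCompact_closure
  obtain ⟨K, hK, hK1, hK2⟩ := exists_common_bound hcomp hA'c
  set D := diam (closure Ω) + 1 with hD
  have hDp : 0 < D := by have := diam_nonneg (s := closure Ω); linarith
  set ρ := min (η / (4 * M)) (d₀ / 8) with hρ
  have hρp : 0 < ρ := lt_min (by positivity) (by positivity)
  have hρ1 : M * ρ ≤ η / 4 := by
    have : ρ ≤ η / (4 * M) := min_le_left _ _
    rw [le_div_iff₀ (by positivity)] at this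
    linarith
  have hρ2 : ρ ≤ d₀ / 8 := min_le_right _ _
  obtain ⟨k, hk, C, hC, δ0, hδ0, hδ01, H⟩ := core_lemma n hlam hK hDp hΛ.le hM
    (d := d₀ / 8) (η := η / 2) (by positivity) (by positivity) hρp
  obtain ⟨b, hb, hb'⟩ := exists_exp_small (P := 1) (Q := η / 2) one_pos (by positivity)
  rw [one_mul] at hb'
  refine ⟨k, hk, max C b, lt_of_lt_of_le hC (le_max_left _ _), min δ0 (d₀ ^ 2 / 16),
    lt_min hδ0 (by positivity), ?_⟩
  intro q u hq hu hu1 hsol hbd x hx δ hδ hδle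
  obtain ⟨-, huM, hduM⟩ := hu1
  have hδ1 : δ ≤ δ0 := hδle.trans (min_le_left _ _)
  have hδ2 : δ ≤ d₀ ^ 2 / 16 := hδle.trans (min_le_right _ _)
  have hδk : 1 ≤ δ⁻¹ ^ k := one_le_pow₀ ((one_le_inv₀ hδ).mpr (hδ1.trans hδ01))
  have hexp : Real.exp (-(max C b * δ⁻¹ ^ k)) ≤ η / 2 := by
    refine le_trans (Real.exp_le_exp.mpr ?_) hb'
    have h1 : b ≤ max C b := le_max_right _ _
    have h2 : max C b * 1 ≤ max C b * δ⁻¹ ^ k :=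
      mul_le_mul_of_nonneg_left hδk (hb.trans h1)
    linarith
  have triv : η / 2 ≤ |u x| →
      ∃ y ∈ Ω, ‖y - x‖ ≤ 2 * Real.sqrt δ ∧ Real.exp (-(max C b * δ⁻¹ ^ k)) ≤ |u y| := by
    intro h
    refine ⟨x, hx, ?_, hexp.trans h⟩
    rw [sub_self, norm_zero]; positivity
  set r := infDist x (frontier Ω) with hr
  rcases le_or_gt r d₀ with hrd | hrd
  · apply triv
    have := hbd x (subset_closure hx) hrd
    linarith
  have hrp : 0 < r := by linarith
  have hball : ball x r ⊆ Ω := ball_sub_Omega hΩo hx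
  obtain ⟨p, hpF, hp⟩ := isClosed_frontier.exists_infDist_eq_dist hFne x
  rw [← hr] at hp
  have hpx : ‖p - x‖ = r := by rw [hp, dist_comm, dist_eq_norm]
  set y0 : EE n := x + ((r - d₀) / r) • (p - x) with hy0
  have hy0x : ‖y0 - x‖ = r - d₀ := by
    rw [hy0, add_sub_cancel_left, norm_smul, hpx, Real.norm_eq_abs, abs_of_nonneg]
    · field_simp
    · apply div_nonneg <;> linarith
  have hy0p : dist y0 p = d₀ := by
    rw [dist_comm, dist_eq_norm]
    have : p - y0 = (d₀ / r) • (p - x) := by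
      have e : d₀ / r = 1 - (r - d₀) / r := by field_simp; ring
      rw [e, sub_smul, one_smul, hy0]; abel
    rw [this, norm_smul, hpx, Real.norm_eq_abs, abs_of_pos (by positivity)]
    field_simp
  have hy0b : y0 ∈ ball x r := by rw [mem_ball, dist_eq_norm, hy0x]; linarith
  have huy0 : η ≤ |u y0| := by
    refine hbd y0 (subset_closure (hball hy0b)) ?_
    exact (infDist_le_dist_of_mem hpF).trans hy0p.le
  have hlip : ∀ y ∈ ball x r, |u y0| - M * ‖y - y0‖ ≤ |u y| := by
    intro y hy
    have h1 := (convex_ball x r).norm_image_sub_le_of_norm_fderiv_le (𝕜 := ℝ) (f := u) (C := M)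
      (fun z hz => (hu.contDiffAt (hΩo.mem_nhds (hball hz))).differentiableAt (by norm_num))
      (fun z hz => hduM z (hball hz)) hy0b hy
    rw [Real.norm_eq_abs] at h1
    have h2 := abs_sub_abs_le_abs_sub (u y0) (u y)
    rw [abs_sub_comm] at h2
    linarith
  rcases le_or_gt (r - d₀) (2 * ρ) with hr2 | hr2
  · apply triv
    have h1 := hlip x (mem_ball_self hrp)
    rw [norm_sub_rev, hy0x] at h1
    have h2 : M * (r - d₀) ≤ M * (2 * ρ) := mul_le_mul_of_nonneg_left hr2 hM.le
    linarith
  have hcb : ∀ z ∈ closedBall x (r - d₀ / 2), z ∈ Ω ∧ d₀ / 2 ≤ infDist z (frontier Ω) := by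
    intro z hz
    rw [mem_closedBall] at hz
    refine ⟨hball (by rw [mem_ball]; linarith), ?_⟩
    have := infDist_le_infDist_add_dist (s := frontier Ω) (x := x) (y := z)
    rw [dist_comm] at this
    linarith
  set u' : EE n → ℝ := fun x => χ x * u x with hu'
  have hu'c : ContDiff ℝ 2 u' := by
    have := cutoff_mul hΩo (k := 2) le_rfl hχ hχ0 (g := u) (by exact_mod_cast hu)
    exact_mod_cast this
  have eqA : ∀ z ∈ Ω, d₀ / 4 ≤ infDist z (frontier Ω) → ∀ i j, A' i j =ᶠ[nhds z] A i j := by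
    intro z hz hz1 i j
    filter_upwards [hχ1 z hz hz1] with y hy
    simp only [hA', hy, one_mul]
  have equ : ∀ z ∈ Ω, d₀ / 4 ≤ infDist z (frontier Ω) → u' =ᶠ[nhds z] u := by
    intro z hz hz1
    filter_upwards [hχ1 z hz hz1] with y hy
    simp only [hu', hy, one_mul]
  have hLLeq : ∀ z ∈ Ω, d₀ / 4 ≤ infDist z (frontier Ω) → LL A' u' z = - (q z * u' z) := by
    intro z hz hz1
    rw [← LL_eq (fun i j => ((hA'c i j).differentiable (by norm_num)).differentiableAt)
      (fun j => ((contDiff_pd2 j hu'c).differentiable (by norm_num)).differentiableAt),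
      LL_congr (eqA z hz hz1) (equ z hz hz1), (equ z hz hz1).eq_of_nhds]
    have := hsol z hz
    linarith
  set U : Set (EE n) := Ω ∩ {z | d₀ / 4 < infDist z (frontier Ω)} with hU
  have hUo : IsOpen U := hΩo.inter (isOpen_lt continuous_const (continuous_infDist_pt _))
  have hLLb : ∀ z ∈ U, |LL A' u' z| - Λ * |u' z| ≤ 0 := by
    apply ae_to_all hUo
    · exact (continuous_LL hA'c hu'c).abs.sub (continuous_const.mul hu'c.continuous.abs)
    · have h1 := ae_restrict_of_ae_restrict_of_subset (inter_subset_left : U ⊆ Ω) hq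
      filter_upwards [h1, ae_restrict_mem hUo.measurableSet] with z hz1 hz2
      have hz3 : d₀ / 4 < infDist z (frontier Ω) := hz2.2
      rw [hLLeq z hz2.1 hz3.le, abs_neg, abs_mul]
      have := mul_le_mul_of_nonneg_right hz1 (abs_nonneg (u' z))
      linarith
  have hrD : r ≤ diam (closure Ω) := by
    rw [hp]
    exact dist_le_diam_of_mem hcomp.isBounded (subset_closure hx) (frontier_subset_closure hpF)
  obtain ⟨y, hy1, hy2⟩ := H A' hA'c hA's x u' hu'c (r - d₀ / 2) δ (by linarith) (by linarith)
    hδ hδ1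
    (fun z hz => hK1 z (subset_closure (hcb z hz).1))
    (fun z hz => hK2 z (subset_closure (hcb z hz).1))
    (by
      intro z hz ξ
      obtain ⟨hz1, hz2⟩ := hcb z hz
      have h1 := hell z hz1 (WithLp.toLp 2 ξ)
      rw [EuclideanSpace.norm_sq_eq] at h1
      simp only [Real.norm_eq_abs, sq_abs] at h1
      refine h1.trans (le_of_eq ?_)
      refine Finset.sum_congr rfl fun i _ => ?_
      rw [Finset.sum_mul]
      refine Finset.sum_congr rfl fun j _ => ?_
      rw [(eqA z hz1 (by linarith) i j).eq_of_nhds]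
      ring)
    (by
      intro z hz
      obtain ⟨hz1, hz2⟩ := hcb z hz
      rw [(equ z hz1 (by linarith)).eq_of_nhds]
      exact huM z (subset_closure hz1))
    (by
      intro z hz i
      obtain ⟨hz1, hz2⟩ := hcb z hz
      rw [pd_congr i (equ z hz1 (by linarith))]
      exact (abs_pd_le i u z).trans (hduM z hz1))
    (by
      intro z hz
      obtain ⟨hz1, hz2⟩ := hcb z hz
      have hz3 : d₀ / 4 < infDist z (frontier Ω) := by linarith
      have := hLLb z ⟨hz1, hz3⟩
      linarith)
    y0
    (by
      intro y hy
      rw [mem_ball, dist_eq_norm] at hy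
      have h1 : ‖y - x‖ ≤ ‖y - y0‖ + ‖y0 - x‖ := norm_sub_le_norm_sub_add_norm_sub _ _ _
      have h2 : ‖y0 - x‖ ≤ ‖y0 - y‖ + ‖y - x‖ := norm_sub_le_norm_sub_add_norm_sub _ _ _
      rw [norm_sub_rev y0 y] at h2
      have h3 : y ∈ closedBall x (r - d₀ / 2) := by
        rw [mem_closedBall, dist_eq_norm]; linarith
      refine ⟨by linarith, by linarith, ?_⟩
      obtain ⟨hz1, hz2⟩ := hcb y h3
      rw [(equ y hz1 (by linarith)).eq_of_nhds]
      have h4 := hlip y (by rw [mem_ball, dist_eq_norm]; linarith)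
      have h5 := mul_le_mul_of_nonneg_left hy.le hM.le
      linarith)
  rw [NN_eq] at hy1
  have hyx : ‖y - x‖ ≤ 2 * Real.sqrt δ := by
    apply le_of_sq_le_sq _ (by positivity)
    rw [mul_pow, Real.sq_sqrt hδ.le]
    linarith
  have hsq : Real.sqrt δ ≤ d₀ / 4 := by
    rw [show d₀ / 4 = Real.sqrt ((d₀ / 4) ^ 2) from (Real.sqrt_sq (by positivity)).symm]
    apply Real.sqrt_le_sqrt
    linarith
  obtain ⟨hz1, hz2⟩ := hcb y (by rw [mem_closedBall, dist_eq_norm]; linarith)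
  refine ⟨y, hz1, hyx, ?_⟩
  rw [(equ y hz1 (by linarith)).eq_of_nhds] at hy2
  refine le_trans (Real.exp_le_exp.mpr ?_) hy2
  have h1 : C ≤ max C b := le_max_left _ _
  have := mul_le_mul_of_nonneg_right h1 (zero_le_one.trans hδk)
  linarith

theorem stmt_14 {n : ℕ} (hn : n = 2 ∨ n = 3)
    (Ω : Set (EuclideanSpace ℝ (Fin n)))
    (hΩo : IsOpen Ω) (hΩb : Bornology.IsBounded Ω) (hΩc : IsConnected Ω)
    (hcone : UniformIntConeProperty Ω)
    (m : ℕ) (hm : 0 < m) (hbl : BrokenLineCond Ω m)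
    (A : Fin n → Fin n → EuclideanSpace ℝ (Fin n) → ℝ) (hA : EllipticSym Ω A)
    (Λ M η d₀ α : ℝ) (hΛ : 0 < Λ) (hM : 0 < M) (hη : 0 < η) (hd₀ : 0 < d₀)
    (hα : 0 < α) (hα' : α ≤ 1) :
    ∃ C₀ > 0, ∃ C₁ > 0, ∀ q u f : EuclideanSpace ℝ (Fin n) → ℝ,
      Measurable q → (∀ᵐ x ∂(volume.restrict Ω), |q x| ≤ Λ) →
      ContDiffOn ℝ 2 u Ω → C1BoundOn Ω u M → IsSolution A q u Ω →
      (∀ x ∈ closure Ω, infDist x (frontier Ω) ≤ d₀ → η ≤ |u x|) →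
      HolderBoundOn Ω f α M →
      ∀ s : ℝ, IsLUB ((fun x => |f x * (u x) ^ 2|) '' Ω) s → 0 < s → s < 1 →
        ∀ x ∈ Ω, |f x| ≤
          C₀ * ((|Real.log (C₁ * |Real.log s|)| ^ (1 / α))⁻¹ + s) := by
  have hn0 : n ≠ 0 := by omega
  obtain ⟨k, hk, C, hC, δ0, hδ0, H⟩ :=
    main_local hn0 Ω hΩo hΩb hΩc.nonempty A hA Λ M η d₀ hΛ hM hη hd₀
  obtain ⟨C₀, hC₀, HF⟩ := final_asym hk hC hM hδ0 hα
  refine ⟨C₀, hC₀, 1, one_pos, ?_⟩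
  intro q u f _ hq hu hu1 hsol hbd hf s hs hs0 hs1 x hx
  obtain ⟨h, hh, hf1, hf2⟩ := hf
  have hxM := hf2 x (subset_closure hx)
  refine HF s hs0 hs1 _ (by linarith) ?_
  intro δ hδ hδ1
  obtain ⟨y, hy, hyx, hyu⟩ := H q u hq hu hu1 hsol hbd x hx δ hδ hδ1
  have h1 := hf1 x (subset_closure hx) y (subset_closure hy)
  have h2 : |f y * u y ^ 2| ≤ s := hs.1 ⟨y, hy, rfl⟩
  rw [abs_mul, abs_pow] at h2
  have h3 : ‖x - y‖ ^ α ≤ (2 * Real.sqrt δ) ^ α := by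
    rw [norm_sub_rev]
    exact Real.rpow_le_rpow (norm_nonneg _) hyx hα.le
  have h4 : h ≤ M := by have := abs_nonneg (f x); linarith
  have h5 : h * ‖x - y‖ ^ α ≤ M * (2 * Real.sqrt δ) ^ α :=
    mul_le_mul h4 h3 (by positivity) hM.le
  have h6 : |f y| ≤ s * Real.exp (2 * (C * δ⁻¹ ^ k)) := by
    set E := C * δ⁻¹ ^ k
    have g1 : Real.exp (-E) ^ 2 ≤ |u y| ^ 2 := pow_le_pow_left₀ (Real.exp_pos _).le hyu 2
    have g2 : |f y| * Real.exp (-E) ^ 2 ≤ s :=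
      (mul_le_mul_of_nonneg_left g1 (abs_nonneg _)).trans h2
    have g3 := mul_le_mul_of_nonneg_right g2 (Real.exp_pos (2 * E)).le
    have g4 : Real.exp (-E) ^ 2 * Real.exp (2 * E) = 1 := by
      rw [← Real.exp_nat_mul, ← Real.exp_add]
      simp
    rwa [mul_assoc, g4, mul_one] at g3
  have h7 := abs_sub_abs_le_abs_sub (f x) (f y)
  linarith
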